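/- In the setting of the main theorem (quaternary (V,φ) over a number field, h with φ[h]=q≠0, W=(Fh)^⊥, ψ=φ|_W, L a g-maximal lattice in V, 𝔬 = A⁺(L∩W)): the SO^ψ-genus of L∩W is determined by the genus of 𝔬; namely, for every α ∈ SO^ψ_A the order A⁺((L∩W)α) belongs to the genus {β⁻¹𝔬β : β ∈ A⁺(W)×_A} of 𝔬, and conversely every order in the genus of 𝔬 equals A⁺(N) for some lattice N in the SO^ψ-genus of L∩W. -/

import Mathlib

noncomputable section

namespace Paper

variable (R F : Type*) [CommRing R] [Field F] [Algebra R F]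

section Lattices

variable (W : Type*) [AddCommGroup W] [Module F W] [Module R W] [IsScalarTower R F W]

/-- A `g`-lattice in `W`: a finitely generated `R`-submodule containing an `F`-basis. -/
def IsLat (L : Submodule R W) : Prop :=
  L.FG ∧ Submodule.span F (L : Set W) = ⊤

/-- integral lattice with respect to a bilinear form -/
def IsIntegralLat (ψ : LinearMap.BilinForm F W) (L : Submodule R W) : Prop :=
  IsLat R F W L ∧ ∀ x ∈ L, ψ x x ∈ (algebraMap R F).range

/-- maximal lattice with respect to a bilinear form -/
def IsMaximalLat (ψ : LinearMap.BilinForm F W) (L : Submodule R W) : Prop :=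
  IsIntegralLat R F W ψ L ∧ ∀ L' : Submodule R W, IsIntegralLat R F W ψ L' → L ≤ L' → L' = L

/-- the ideal `[L/M]` generated by determinants of `F`-automorphisms carrying `L` into `M` -/
def latIdx (L M : Submodule R W) : Submodule R F :=
  Submodule.span R {d : F | ∃ α : W ≃ₗ[F] W, (∀ x ∈ L, α x ∈ M) ∧
    LinearMap.det (α : W →ₗ[F] W) = d}

/-- the dual lattice `L~ = {x | 2ψ(x,L) ⊆ g}` -/
def dualLat (ψ : LinearMap.BilinForm F W) (L : Submodule R W) : Submodule R W :=
  ⨅ y ∈ L, Submodule.comap (((2 : F) • (ψ.flip y)).restrictScalars R)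
    (LinearMap.range (Algebra.linearMap R F))

/-- the ideal `[L/M]` for lattices spanning the subspace `U`, computed inside `U` -/
def latIdxIn (U : Submodule F W) (L M : Submodule R W) : Submodule R F :=
  latIdx R F ↥U (Submodule.comap ((U.subtype).restrictScalars R) L)
    (Submodule.comap ((U.subtype).restrictScalars R) M)

/-- product of a fractional ideal and a lattice -/
def idSMul {M : Type*} [AddCommGroup M] [Module F M] [Module R M] [IsScalarTower R F M]
    (I : Submodule R F) (N : Submodule R M) : Submodule R M :=
  Submodule.span R {z : M | ∃ c ∈ I, ∃ x ∈ N, z = c • x}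

end Lattices

/-- the fractional ideal attached to an integral ideal -/
def idealToF (I : Ideal R) : Submodule R F :=
  Submodule.map (Algebra.linearMap R F) I

section Clifford

variable (W : Type*) [AddCommGroup W] [Module F W] [Module R W] [IsScalarTower R F W]
variable (Q : QuadraticForm F W)

/-- the order `A(N)` generated by `g` and `N` in the Clifford algebra -/
def cliffordOrder (N : Submodule R W) : Subalgebra R (CliffordAlgebra Q) :=
  Algebra.adjoin R (CliffordAlgebra.ι Q '' (N : Set W))

/-- the even Clifford algebra, as an `R`-subalgebra -/
def evenR : Subalgebra R (CliffordAlgebra Q) :=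
  (CliffordAlgebra.even Q).restrictScalars R

/-- `A⁺(N) = A⁺(W) ∩ A(N)` -/
def APlus (N : Submodule R W) : Subalgebra R (CliffordAlgebra Q) :=
  evenR R F W Q ⊓ cliffordOrder R F W Q N

def APlusSub (N : Submodule R W) : Submodule R (CliffordAlgebra Q) :=
  Subalgebra.toSubmodule (APlus R F W Q N)

def oneLat : Submodule R (CliffordAlgebra Q) :=
  LinearMap.range (Algebra.linearMap R (CliffordAlgebra Q))

/-- the `R`-linear map `x ↦ 2ν(x,y) = x·y* + y·x*`, where `*` is the canonical
involution (reversal) of the Clifford algebra -/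
def traceMap (y : CliffordAlgebra Q) : CliffordAlgebra Q →ₗ[R] CliffordAlgebra Q :=
  ((LinearMap.mulRight F (CliffordAlgebra.reverse (Q := Q) y)) +
    (LinearMap.mulLeft F y) ∘ₗ (CliffordAlgebra.reverse (Q := Q))).restrictScalars R

/-- the dual `o~ = {x ∈ A⁺(W) | 2ν(x,o) ⊆ g}` with respect to the norm form
`ν[x] = x x*` of the even Clifford algebra -/
def normDual (o : Submodule R (CliffordAlgebra Q)) : Submodule R (CliffordAlgebra Q) :=
  Subalgebra.toSubmodule (evenR R F W Q) ⊓
    ⨅ y ∈ o, Submodule.comap (traceMap R F W Q y) (oneLat R F W Q)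

/-- `A⁺(W)° = {x ∈ A⁺(W) | x* = -x}`, as an `R`-submodule -/
def minusPart : Submodule R (CliffordAlgebra Q) :=
  Subalgebra.toSubmodule (evenR R F W Q) ⊓
    LinearMap.ker ((CliffordAlgebra.reverse (Q := Q) + LinearMap.id).restrictScalars R)

end Clifford

end Paper

namespace Paper

section Orders

variable (R F : Type*) [CommRing R] [Field F] [Algebra R F]
variable (A : Type*) [Ring A] [Algebra F A] [Algebra R A] [IsScalarTower R F A]

/-- an order in the `F`-subalgebra `B` of `A`: an `R`-subalgebra which is an `R`-lattice
in `B` -/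
def IsOrderIn (B : Subalgebra F A) (o : Subalgebra R A) : Prop :=
  (Subalgebra.toSubmodule o).FG ∧ (o : Set A) ⊆ (B : Set A) ∧
    Submodule.span F (o : Set A) = Subalgebra.toSubmodule B

/-- a maximal order in `B` -/
def IsMaximalOrderIn (B : Subalgebra F A) (o : Subalgebra R A) : Prop :=
  IsOrderIn R F A B o ∧ ∀ o' : Subalgebra R A, IsOrderIn R F A B o' → o ≤ o' → o' = o

end Orders

section Abbrev

variable (R F : Type*) [CommRing R] [Field F] [Algebra R F]
variable (W : Type*) [AddCommGroup W] [Module F W] [Module R W] [IsScalarTower R F W]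
variable (psi : LinearMap.BilinForm F W)

/-- the ideal `[A⁺(M)/A⁺(N)]`, computed inside the quaternion algebra `A⁺(W)` -/
def APlusIdx (M N : Submodule R W) : Submodule R F :=
  latIdxIn R F (CliffordAlgebra (LinearMap.BilinMap.toQuadraticMap psi))
    (Subalgebra.toSubmodule
      (CliffordAlgebra.even (LinearMap.BilinMap.toQuadraticMap psi)))
    (APlusSub R F W (LinearMap.BilinMap.toQuadraticMap psi) M)
    (APlusSub R F W (LinearMap.BilinMap.toQuadraticMap psi) N)

/-- the ideal `[A⁺(N)~/A⁺(N)]`, computed inside the quaternion algebra `A⁺(W)` -/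
def APlusDualIdx (N : Submodule R W) : Submodule R F :=
  latIdxIn R F (CliffordAlgebra (LinearMap.BilinMap.toQuadraticMap psi))
    (Subalgebra.toSubmodule
      (CliffordAlgebra.even (LinearMap.BilinMap.toQuadraticMap psi)))
    (normDual R F W (LinearMap.BilinMap.toQuadraticMap psi)
      (APlusSub R F W (LinearMap.BilinMap.toQuadraticMap psi) N))
    (APlusSub R F W (LinearMap.BilinMap.toQuadraticMap psi) N)

/-- the fractional ideal `2⁻¹·[Ñ/N]` -/
def halfDualIdx (N : Submodule R W) : Submodule R F :=
  Submodule.span R {((2 : F)⁻¹)} * latIdx R F W (dualLat R F W psi N) N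

end Abbrev

end Paper

namespace Paper

section SOConj

variable (R F : Type*) [CommRing R] [Field F] [Algebra R F]
variable (W : Type*) [AddCommGroup W] [Module F W] [Module R W] [IsScalarTower R F W]

/-- membership in the special orthogonal group `SO^ψ` -/
def IsSOElem (ψ : LinearMap.BilinForm F W) (γ : W ≃ₗ[F] W) : Prop :=
  (∀ x y, ψ (γ x) (γ y) = ψ x y) ∧ LinearMap.det (γ : W →ₗ[F] W) = 1

/-- the (right) action of `γ` on lattices -/
def latAction (γ : W ≃ₗ[F] W) (N : Submodule R W) : Submodule R W :=
  Submodule.map ((γ : W →ₗ[F] W).restrictScalars R) N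

variable (Q : QuadraticForm F W)

/-- a unit of the even Clifford algebra `A⁺(W)`, i.e. of the even Clifford group
`G⁺(W)` (for ternary spaces `G⁺(W) = A⁺(W)ˣ`) -/
def IsGPlusUnit (α : (CliffordAlgebra Q)ˣ) : Prop :=
  ((α : CliffordAlgebra Q) ∈ CliffordAlgebra.even Q) ∧
    (((α⁻¹ : (CliffordAlgebra Q)ˣ) : CliffordAlgebra Q) ∈ CliffordAlgebra.even Q)

/-- conjugation `x ↦ α⁻¹ x α` as an `R`-linear map -/
def conjMap (α : (CliffordAlgebra Q)ˣ) : CliffordAlgebra Q →ₗ[R] CliffordAlgebra Q :=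
  ((LinearMap.mulLeft F (((α⁻¹ : (CliffordAlgebra Q)ˣ) : CliffordAlgebra Q))).comp
    (LinearMap.mulRight F (α : CliffordAlgebra Q))).restrictScalars R

/-- `γ = τ(α)`: the automorphism `γ` of `W` is induced by conjugation by `α` via the
homomorphism `τ : G⁺(W) → SO^ψ`, `x·τ(α) = α⁻¹ x α`. -/
def IsTau (γ : W ≃ₗ[F] W) (α : (CliffordAlgebra Q)ˣ) : Prop :=
  ∀ x : W, CliffordAlgebra.ι Q (γ x) =
    ((α⁻¹ : (CliffordAlgebra Q)ˣ) : CliffordAlgebra Q) * CliffordAlgebra.ι Q x *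
      (α : CliffordAlgebra Q)

end SOConj

section Genus

open IsDedekindDomain

variable (R F : Type*) [CommRing R] [IsDedekindDomain R] [Field F] [Algebra R F]
variable (W : Type*) [AddCommGroup W] [Module F W] [Module R W] [IsScalarTower R F W]

/-- the localization `N_(v)` of an `R`-submodule `N` at a finite prime `v`,
taken inside the ambient vector space -/
def localAt (v : HeightOneSpectrum R) (N : Submodule R W) : Submodule R W where
  carrier := {x | ∃ s : R, s ∉ v.asIdeal ∧ s • x ∈ N}
  zero_mem' := ⟨1, fun hmem =>
    v.isPrime.ne_top (Ideal.eq_top_of_isUnit_mem _ hmem isUnit_one), by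
      simp⟩
  add_mem' := by
    rintro x y ⟨s, hs, hsx⟩ ⟨t, ht, hty⟩
    refine ⟨s * t, fun hmem => ?_, ?_⟩
    · rcases v.isPrime.mem_or_mem hmem with hmem | hmem
      exacts [hs hmem, ht hmem]
    · have hx' : (s * t) • x ∈ N := by
        rw [mul_comm, mul_smul]; exact N.smul_mem t hsx
      have hy' : (s * t) • y ∈ N := by
        rw [mul_smul]; exact N.smul_mem s hty
      simpa [smul_add] using N.add_mem hx' hy'
  smul_mem' := by
    rintro r x ⟨s, hs, hsx⟩
    exact ⟨s, hs, by rw [smul_comm]; exact N.smul_mem r hsx⟩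

/-- `N` belongs to the `SO^ψ`-genus of `L0`: at every finite prime the localizations
are carried into each other by an element of the special orthogonal group. -/
def InGenus (ψ : LinearMap.BilinForm F W) (L0 N : Submodule R W) : Prop :=
  ∀ v : HeightOneSpectrum R, ∃ γ : W ≃ₗ[F] W, IsSOElem F W ψ γ ∧
    latAction R F W γ (localAt R W v N) = localAt R W v L0

variable (Q : QuadraticForm F W)

/-- `o` belongs to the genus `{β⁻¹ o0 β | β ∈ A⁺(W)ˣ_𝐀}` of the order `o0` -/
def OrderInGenus (o0 o : Submodule R (CliffordAlgebra Q)) : Prop :=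
  ∀ v : HeightOneSpectrum R, ∃ α : (CliffordAlgebra Q)ˣ, IsGPlusUnit F W Q α ∧
    Submodule.map (conjMap R F W Q α) (localAt R (CliffordAlgebra Q) v o0) =
      localAt R (CliffordAlgebra Q) v o

end Genus

end Paper

namespace Paper

section TernaryClifford

open CliffordAlgebra Module

variable {F W : Type*} [Field F] [AddCommGroup W] [Module F W] {Q : QuadraticForm F W}

/-- `e` is an orthogonal basis of anisotropic vectors. -/
structure IsOrthoBasis (Q : QuadraticForm F W) (e : Basis (Fin 3) F W) : Prop where
  polar_eq_zero : ∀ i j, i ≠ j → QuadraticMap.polar Q (e i) (e j) = 0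
  ne_zero : ∀ i, Q (e i) ≠ 0

/-- The product of the three basis vectors in the Clifford algebra. -/
def vol (Q : QuadraticForm F W) (e : Basis (Fin 3) F W) : CliffordAlgebra Q :=
  ι Q (e 0) * ι Q (e 1) * ι Q (e 2)

lemma ι_anticomm {x y : W} (h : QuadraticMap.polar Q x y = 0) :
    ι Q y * ι Q x = -(ι Q x * ι Q y) := by
  have := ι_mul_ι_add_swap (Q := Q) x y
  rw [h, map_zero] at this
  exact eq_neg_of_add_eq_zero_right this

lemma ι_sq_smul (x : W) : ι Q x * ι Q x = Q x • (1 : CliffordAlgebra Q) := by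
  rw [ι_sq_scalar, Algebra.algebraMap_eq_smul_one]

lemma ι_mul_ι_mul_self (x : W) (y : CliffordAlgebra Q) : ι Q x * (ι Q x * y) = Q x • y := by
  rw [← mul_assoc, ι_sq_smul, smul_mul_assoc, one_mul]

variable {e : Basis (Fin 3) F W}

lemma IsOrthoBasis.anticomm (he : IsOrthoBasis Q e) {i j : Fin 3} (h : i ≠ j) :
    ι Q (e j) * ι Q (e i) = -(ι Q (e i) * ι Q (e j)) :=
  ι_anticomm (he.polar_eq_zero i j h)

lemma IsOrthoBasis.anticomm_mul (he : IsOrthoBasis Q e) {i j : Fin 3} (h : i ≠ j)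
    (x : CliffordAlgebra Q) :
    ι Q (e j) * (ι Q (e i) * x) = -(ι Q (e i) * (ι Q (e j) * x)) := by
  rw [← mul_assoc, he.anticomm h, neg_mul, mul_assoc]

lemma IsOrthoBasis.basis_mul_vol (he : IsOrthoBasis Q e) (i : Fin 3) :
    ι Q (e i) * vol Q e = vol Q e * ι Q (e i) := by
  have h20 := he.anticomm (i := 0) (j := 2) (by decide)
  have h21 := he.anticomm (i := 1) (j := 2) (by decide)
  have k10 := he.anticomm_mul (i := 0) (j := 1) (by decide)
  have k20 := he.anticomm_mul (i := 0) (j := 2) (by decide)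
  have k21 := he.anticomm_mul (i := 1) (j := 2) (by decide)
  fin_cases i <;>
    simp [vol, mul_assoc, h20, h21, k10, k20, k21, ι_mul_ι_mul_self]

lemma IsOrthoBasis.ι_mul_vol (he : IsOrthoBasis Q e) (x : W) :
    ι Q x * vol Q e = vol Q e * ι Q x := by
  rw [← e.sum_repr x]
  simp only [map_sum, map_smul, Finset.sum_mul, Finset.mul_sum, smul_mul_assoc, mul_smul_comm,
    he.basis_mul_vol]

lemma IsOrthoBasis.mul_vol (he : IsOrthoBasis Q e) (y : CliffordAlgebra Q) :
    y * vol Q e = vol Q e * y := by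
  induction y using CliffordAlgebra.induction with
  | algebraMap r => exact Algebra.commutes r _
  | ι x => exact he.ι_mul_vol x
  | mul a b ha hb => rw [mul_assoc, hb, ← mul_assoc, ha, mul_assoc]
  | add a b ha hb => rw [add_mul, mul_add, ha, hb]

/-- The square of `vol`. -/
def volSq (Q : QuadraticForm F W) (e : Basis (Fin 3) F W) : F := -(Q (e 0) * Q (e 1) * Q (e 2))

lemma IsOrthoBasis.volSq_ne_zero (he : IsOrthoBasis Q e) : volSq Q e ≠ 0 :=
  neg_ne_zero.2 (mul_ne_zero (mul_ne_zero (he.ne_zero 0) (he.ne_zero 1)) (he.ne_zero 2))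

lemma IsOrthoBasis.vol_mul_vol (he : IsOrthoBasis Q e) :
    vol Q e * vol Q e = volSq Q e • (1 : CliffordAlgebra Q) := by
  have k10 := he.anticomm_mul (i := 0) (j := 1) (by decide)
  have k20 := he.anticomm_mul (i := 0) (j := 2) (by decide)
  have k21 := he.anticomm_mul (i := 1) (j := 2) (by decide)
  simp [vol, volSq, mul_assoc, k10, k20, k21, smul_smul,
    Algebra.algebraMap_eq_smul_one]
  congr 1
  ring

lemma IsOrthoBasis.mul_vol_mul_vol (he : IsOrthoBasis Q e) (y : CliffordAlgebra Q) :
    y * vol Q e * vol Q e = volSq Q e • y := by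
  rw [mul_assoc, he.vol_mul_vol, mul_smul_comm, mul_one]

lemma IsOrthoBasis.mul_vol_injective (he : IsOrthoBasis Q e) {x y : CliffordAlgebra Q}
    (h : x * vol Q e = y * vol Q e) : x = y := by
  have := congr_arg (· * vol Q e) h
  simp only [he.mul_vol_mul_vol] at this
  exact smul_right_injective _ he.volSq_ne_zero this

lemma IsOrthoBasis.reverse_vol (he : IsOrthoBasis Q e) : reverse (vol Q e) = -vol Q e := by
  have h20 := he.anticomm (i := 0) (j := 2) (by decide)
  have h21 := he.anticomm (i := 1) (j := 2) (by decide)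
  have k10 := he.anticomm_mul (i := 0) (j := 1) (by decide)
  simp [vol, mul_assoc, h20, h21, k10, reverse.map_mul]

lemma IsOrthoBasis.reverse_ι_mul_vol (he : IsOrthoBasis Q e) (w : W) :
    reverse (ι Q w * vol Q e) = -(ι Q w * vol Q e) := by
  rw [reverse.map_mul, he.reverse_vol, reverse_ι, he.ι_mul_vol, neg_mul]

lemma IsOrthoBasis.basis_one_mul_two (he : IsOrthoBasis Q e) :
    ι Q (e 1) * ι Q (e 2) = (Q (e 0))⁻¹ • (ι Q (e 0) * vol Q e) := by
  simp [vol, mul_assoc, ι_mul_ι_mul_self, he.ne_zero 0]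

lemma IsOrthoBasis.basis_zero_mul_two (he : IsOrthoBasis Q e) :
    ι Q (e 0) * ι Q (e 2) = -((Q (e 1))⁻¹ • (ι Q (e 1) * vol Q e)) := by
  have k10 := he.anticomm_mul (i := 0) (j := 1) (by decide)
  simp [vol, mul_assoc, k10, ι_mul_ι_mul_self, he.ne_zero 1]

lemma IsOrthoBasis.basis_zero_mul_one (he : IsOrthoBasis Q e) :
    ι Q (e 0) * ι Q (e 1) = (Q (e 2))⁻¹ • (ι Q (e 2) * vol Q e) := by
  have k20 := he.anticomm_mul (i := 0) (j := 2) (by decide)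
  have k21 := he.anticomm_mul (i := 1) (j := 2) (by decide)
  simp [vol, mul_assoc, k20, k21, Algebra.algebraMap_eq_smul_one, he.ne_zero 2]

lemma IsOrthoBasis.exists_basis_mul_basis (he : IsOrthoBasis Q e) (i j : Fin 3) :
    ∃ (a : F) (w : W), ι Q (e i) * ι Q (e j) = a • 1 + ι Q w * vol Q e := by
  have h10 := he.anticomm (i := 0) (j := 1) (by decide)
  have h20 := he.anticomm (i := 0) (j := 2) (by decide)
  have h21 := he.anticomm (i := 1) (j := 2) (by decide)
  have m12 := he.basis_one_mul_two
  have m02 := he.basis_zero_mul_two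
  have m01 := he.basis_zero_mul_one
  fin_cases i <;> fin_cases j
  · exact ⟨_, 0, by simpa using! ι_sq_smul (Q := Q) (e 0)⟩
  · exact ⟨0, (Q (e 2))⁻¹ • e 2, by simp [m01]⟩
  · exact ⟨0, -((Q (e 1))⁻¹ • e 1), by simp [m02]⟩
  · exact ⟨0, -((Q (e 2))⁻¹ • e 2), by simp [h10, m01]⟩
  · exact ⟨_, 0, by simpa using! ι_sq_smul (Q := Q) (e 1)⟩
  · exact ⟨0, (Q (e 0))⁻¹ • e 0, by simp [m12]⟩
  · exact ⟨0, (Q (e 1))⁻¹ • e 1, by simp [h20, m02]⟩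
  · exact ⟨0, -((Q (e 0))⁻¹ • e 0), by simp [h21, m12]⟩
  · exact ⟨_, 0, by simpa using! ι_sq_smul (Q := Q) (e 2)⟩

/-- The subspace `F + W·vol` of the Clifford algebra. -/
def scalarAddVec (Q : QuadraticForm F W) (e : Basis (Fin 3) F W) :
    Submodule F (CliffordAlgebra Q) where
  carrier := {y | ∃ (a : F) (w : W), y = a • 1 + ι Q w * vol Q e}
  zero_mem' := ⟨0, 0, by simp⟩
  add_mem' := by
    rintro _ _ ⟨a, w, rfl⟩ ⟨b, u, rfl⟩
    exact ⟨a + b, w + u, by rw [map_add, add_mul, add_smul]; abel⟩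
  smul_mem' := by
    rintro c _ ⟨a, w, rfl⟩
    exact ⟨c * a, c • w, by rw [map_smul, smul_add, smul_mul_assoc, smul_smul]⟩

lemma IsOrthoBasis.ι_mul_ι_mem (he : IsOrthoBasis Q e) (u v : W) :
    ι Q u * ι Q v ∈ scalarAddVec Q e := by
  rw [← e.sum_repr u, ← e.sum_repr v]
  simp only [map_sum, map_smul, Finset.sum_mul, Finset.mul_sum, smul_mul_assoc, mul_smul_comm]
  exact Submodule.sum_mem _ fun i _ => Submodule.smul_mem _ _ <|
    Submodule.sum_mem _ fun j _ => Submodule.smul_mem _ _ (he.exists_basis_mul_basis _ _)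

lemma IsOrthoBasis.ι_mul_ι_mul_mem (he : IsOrthoBasis Q e) (u v : W) {y : CliffordAlgebra Q}
    (hy : y ∈ scalarAddVec Q e) : ι Q u * ι Q v * y ∈ scalarAddVec Q e := by
  obtain ⟨a, w, rfl⟩ := hy
  rw [mul_add, mul_smul_comm, mul_one]
  refine add_mem (Submodule.smul_mem _ _ (he.ι_mul_ι_mem u v)) ?_
  obtain ⟨b, t, h⟩ := he.ι_mul_ι_mem v w
  obtain ⟨c, s, h'⟩ := he.ι_mul_ι_mem u t
  refine ⟨volSq Q e * c, b • u + volSq Q e • s, ?_⟩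
  calc ι Q u * ι Q v * (ι Q w * vol Q e) = ι Q u * (ι Q v * ι Q w) * vol Q e := by
        simp only [mul_assoc]
    _ = b • ι Q u * vol Q e + ι Q u * ι Q t * vol Q e * vol Q e := by
        rw [h]; simp only [mul_add, add_mul, mul_smul_comm, mul_one, mul_assoc]
    _ = _ := by
        rw [he.mul_vol_mul_vol, h']
        simp only [map_add, map_smul, add_mul, smul_add, smul_smul, smul_mul_assoc]
        abel

lemma IsOrthoBasis.exists_of_mem_even (he : IsOrthoBasis Q e) {y : CliffordAlgebra Q}
    (hy : y ∈ even Q) : ∃ (a : F) (w : W), y = a • 1 + ι Q w * vol Q e := by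
  change y ∈ scalarAddVec Q e
  change y ∈ evenOdd Q 0 at hy
  induction y, hy using CliffordAlgebra.even_induction with
  | algebraMap r => exact ⟨r, 0, by simp [Algebra.algebraMap_eq_smul_one]⟩
  | add x y hx hy ihx ihy => exact add_mem ihx ihy
  | ι_mul_ι_mul u v x hx ih => exact he.ι_mul_ι_mul_mem u v ih

lemma ι_mul_ι_mem_even (u v : W) : ι Q u * ι Q v ∈ even Q := ι_mul_ι_mem_evenOdd_zero Q u v

lemma ι_mul_vol_mem_even (w : W) : ι Q w * vol Q e ∈ even Q := by
  have : ι Q w * vol Q e = (ι Q w * ι Q (e 0)) * (ι Q (e 1) * ι Q (e 2)) := by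
    simp only [vol, mul_assoc]
  rw [this]
  exact mul_mem (ι_mul_ι_mem_even _ _) (ι_mul_ι_mem_even _ _)

lemma IsOrthoBasis.mul_reverse (he : IsOrthoBasis Q e) (a : F) (w : W) :
    (a • 1 + ι Q w * vol Q e) * (a • 1 - ι Q w * vol Q e) =
      (a * a - volSq Q e * Q w) • (1 : CliffordAlgebra Q) := by
  have h : ι Q w * vol Q e * (ι Q w * vol Q e) = (volSq Q e * Q w) • 1 := by
    rw [← mul_assoc, mul_assoc (ι Q w), ← he.ι_mul_vol, ← mul_assoc, he.mul_vol_mul_vol,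
      ι_sq_smul, smul_smul]
  rw [mul_sub, add_mul, add_mul, h]
  simp only [smul_mul_assoc, mul_smul_comm, one_mul, mul_one, sub_smul, smul_smul]
  abel

lemma IsOrthoBasis.reverse_eq (he : IsOrthoBasis Q e) (a : F) (w : W) :
    reverse (a • 1 + ι Q w * vol Q e) = a • 1 - ι Q w * vol Q e := by
  rw [map_add, he.reverse_ι_mul_vol, map_smul, reverse.map_one, sub_eq_add_neg]

lemma IsOrthoBasis.exists_norm (he : IsOrthoBasis Q e) {y : CliffordAlgebra Q}
    (hy : y ∈ even Q) :
    ∃ n : F, y * reverse y = n • 1 ∧ reverse y * y = n • 1 := by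
  obtain ⟨a, w, rfl⟩ := he.exists_of_mem_even hy
  refine ⟨a * a - volSq Q e * Q w, ?_, ?_⟩
  · rw [he.reverse_eq, he.mul_reverse]
  · have := he.mul_reverse a (-w)
    simpa [he.reverse_eq, ← sub_eq_add_neg] using this

variable [CharZero F]

lemma smul_one_eq_zero {a : F} (h : a • (1 : CliffordAlgebra Q) = 0) : a = 0 := by
  have : Invertible (2 : F) := invertibleOfNonzero two_ne_zero
  exact (smul_eq_zero.1 h).resolve_right one_ne_zero

lemma ι_inj {x y : W} (h : ι Q x = ι Q y) : x = y := by
  have : Invertible (2 : F) := invertibleOfNonzero two_ne_zero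
  have h' := congr_arg (equivExterior Q) h
  simp only [equivExterior, changeFormEquiv_apply, changeForm_ι] at h'
  exact (ExteriorAlgebra.ι_leftInverse (M := W)).injective h'

lemma IsOrthoBasis.exists_of_reverse_eq_neg (he : IsOrthoBasis Q e) {y : CliffordAlgebra Q}
    (hy : y ∈ even Q) (hr : reverse y = -y) : ∃ w : W, y = ι Q w * vol Q e := by
  obtain ⟨a, w, rfl⟩ := he.exists_of_mem_even hy
  rw [he.reverse_eq, neg_add, sub_eq_add_neg, add_left_inj] at hr
  have h2 : (a + a) • (1 : CliffordAlgebra Q) = 0 := by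
    rw [add_smul]; nth_rw 1 [hr]; exact neg_add_cancel _
  have : a = 0 := add_self_eq_zero.1 (smul_one_eq_zero h2)
  exact ⟨w, by simp [this]⟩

end TernaryClifford

end Paper

namespace Paper

section Tau

open CliffordAlgebra Module

variable {F W : Type*} [Field F] [AddCommGroup W] [Module F W] {Q : QuadraticForm F W}

/-- The alternating map `(u, v, w) ↦ uvw - wvu` with values in the Clifford algebra. -/
def antisymProd (Q : QuadraticForm F W) : W [⋀^Fin 3]→ₗ[F] CliffordAlgebra Q where
  toMultilinearMap :=
    (MultilinearMap.mkPiAlgebraFin F 3 (CliffordAlgebra Q)).compLinearMap (fun _ => ι Q) -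
    ((MultilinearMap.mkPiAlgebraFin F 3 (CliffordAlgebra Q)).compLinearMap
      (fun _ => ι Q)).domDomCongr Fin.revPerm
  map_eq_zero_of_eq' := by
    intro v i j h hij
    have key : ∀ u w : W, ι Q u * (ι Q u * ι Q w) = ι Q w * algebraMap F _ (Q u) := by
      intro u w
      rw [ι_mul_ι_mul_self, Algebra.algebraMap_eq_smul_one, mul_smul_comm, mul_one]
    fin_cases i <;> fin_cases j <;> simp at hij h ⊢ <;>
      simp [h, key]

lemma antisymProd_apply (v : Fin 3 → W) :
    antisymProd Q v = ι Q (v 0) * ι Q (v 1) * ι Q (v 2) - ι Q (v 2) * ι Q (v 1) * ι Q (v 0) := by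
  change (MultilinearMap.mkPiAlgebraFin F 3 (CliffordAlgebra Q)) (fun i => ι Q (v i)) -
    (MultilinearMap.mkPiAlgebraFin F 3 (CliffordAlgebra Q)) (fun i => ι Q (v (Fin.revPerm i))) = _
  simp [List.ofFn_succ, Fin.rev, mul_assoc]

lemma alternating_map_det {C : Type*} [AddCommGroup C] [Module F C] {ι : Type*} [Fintype ι]
    [DecidableEq ι] (T : W [⋀^ι]→ₗ[F] C) (e : Basis ι F W) (γ : W →ₗ[F] W) :
    T (fun i => γ (e i)) = LinearMap.det γ • T e := by
  rw [← sub_eq_zero, ← Module.forall_dual_apply_eq_zero_iff F]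
  intro f
  have h := congr_arg (fun g => g (fun i => γ (e i)))
    (AlternatingMap.eq_smul_basis_det e (f.compAlternatingMap T))
  have hd : e.det (fun i => γ (e i)) = LinearMap.det γ := by
    have := e.det_comp γ e
    simpa [Function.comp_def, e.det_self] using this
  simp only [LinearMap.compAlternatingMap_apply, AlternatingMap.smul_apply, hd] at h
  rw [map_sub, h, map_smul, smul_eq_mul, smul_eq_mul, mul_comm, sub_self]

variable {e : Basis (Fin 3) F W}

lemma IsOrthoBasis.antisymProd_eq (he : IsOrthoBasis Q e) :
    antisymProd Q e = (2 : F) • vol Q e := by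
  have : ι Q (e 2) * ι Q (e 1) * ι Q (e 0) = reverse (vol Q e) := by
    simp [vol, reverse.map_mul, mul_assoc]
  rw [antisymProd_apply, this, he.reverse_vol, sub_neg_eq_add, two_smul, vol]

lemma IsOrthoBasis.map (he : IsOrthoBasis Q e) (γ : W ≃ₗ[F] W) (hγ : ∀ x, Q (γ x) = Q x) :
    IsOrthoBasis Q (e.map γ) where
  polar_eq_zero i j h := by
    have := he.polar_eq_zero i j h
    simpa [QuadraticMap.polar, ← map_add, hγ] using this
  ne_zero i := by simpa [hγ] using he.ne_zero i

variable [CharZero F]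

lemma IsOrthoBasis.vol_map (he : IsOrthoBasis Q e) (γ : W ≃ₗ[F] W) (hγ : ∀ x, Q (γ x) = Q x) :
    vol Q (e.map γ) = LinearMap.det (γ : W →ₗ[F] W) • vol Q e := by
  have h := (he.map γ hγ).antisymProd_eq
  have h' := alternating_map_det (antisymProd Q) e (γ : W →ₗ[F] W)
  rw [he.antisymProd_eq] at h'
  have : (⇑(e.map γ) : Fin 3 → W) = fun i => (γ : W →ₗ[F] W) (e i) := by ext; simp
  rw [this, h', smul_comm] at h
  exact (smul_right_injective _ (two_ne_zero (α := F)) h).symm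

lemma IsOrthoBasis.vol_ne_zero (he : IsOrthoBasis Q e) : vol Q e ≠ 0 := by
  intro h
  have := he.vol_mul_vol
  rw [h, mul_zero] at this
  exact he.volSq_ne_zero (smul_one_eq_zero this.symm)

lemma IsOrthoBasis.exists_conj (he : IsOrthoBasis Q e) {α : (CliffordAlgebra Q)ˣ}
    (hα : IsGPlusUnit F W Q α) (x : W) :
    ∃ y : W, ι Q y = (↑α⁻¹ : CliffordAlgebra Q) * ι Q x * (α : CliffordAlgebra Q) := by
  obtain ⟨n, h1, h2⟩ := he.exists_norm hα.1
  have hn : n ≠ 0 := by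
    rintro rfl
    have : reverse (α : CliffordAlgebra Q) = 0 := by
      have := congr_arg ((↑α⁻¹ : CliffordAlgebra Q) * ·) h1
      simpa using this
    have h0 := congr_arg reverse this
    simp at h0
  have hr : reverse (α : CliffordAlgebra Q) = n • (↑α⁻¹ : CliffordAlgebra Q) := by
    have := congr_arg ((↑α⁻¹ : CliffordAlgebra Q) * ·) h1
    simpa using this
  have hr' : reverse (↑α⁻¹ : CliffordAlgebra Q) = n⁻¹ • (α : CliffordAlgebra Q) := by
    have := congr_arg reverse hr
    rw [reverse_reverse, map_smul] at this
    rw [this, smul_smul, inv_mul_cancel₀ hn, one_smul]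
  obtain ⟨w, hw⟩ := he.exists_of_reverse_eq_neg
    (y := (↑α⁻¹ : CliffordAlgebra Q) * (ι Q x * vol Q e) * (α : CliffordAlgebra Q))
    (mul_mem (mul_mem hα.2 (ι_mul_vol_mem_even x)) hα.1) (by
      rw [reverse.map_mul, reverse.map_mul, he.reverse_ι_mul_vol, hr, hr']
      simp [smul_smul, mul_assoc, hn])
  refine ⟨w, he.mul_vol_injective ?_⟩
  rw [← hw]
  simp only [mul_assoc]
  rw [he.mul_vol (α : CliffordAlgebra Q)]

/-- Conjugation by a unit of the even Clifford algebra of a ternary space, restricted to the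
space. -/
lemma IsOrthoBasis.exists_isTau (he : IsOrthoBasis Q e) {α : (CliffordAlgebra Q)ˣ}
    (hα : IsGPlusUnit F W Q α) :
    ∃ γ : W ≃ₗ[F] W, IsTau F W Q γ α ∧ (∀ x, Q (γ x) = Q x) ∧
      LinearMap.det (γ : W →ₗ[F] W) = 1 := by
  have hα' : IsGPlusUnit F W Q α⁻¹ := ⟨hα.2, by simpa using hα.1⟩
  choose f hf using he.exists_conj hα
  choose g hg using he.exists_conj hα'
  let γ : W ≃ₗ[F] W :=
    { toFun := f
      invFun := g
      map_add' := fun x y => ι_inj (Q := Q) (by simp [hf, mul_add, add_mul])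
      map_smul' := fun c x => ι_inj (Q := Q) (by simp [hf])
      left_inv := fun x => ι_inj (Q := Q) (by simp [hf, hg, mul_assoc])
      right_inv := fun x => ι_inj (Q := Q) (by simp [hf, hg, mul_assoc]) }
  have hτ : IsTau F W Q γ α := hf
  have hQ : ∀ x, Q (γ x) = Q x := by
    intro x
    have h : Q (γ x) • (1 : CliffordAlgebra Q) = Q x • 1 := by
      have h1 : ι Q (γ x) * ι Q (γ x) = (↑α⁻¹ : CliffordAlgebra Q) * (ι Q x * ι Q x) * α := by
        rw [hτ x]; simp only [mul_assoc, Units.mul_inv_cancel_left]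
      rw [ι_sq_smul, ι_sq_smul] at h1
      simpa using h1
    rw [← sub_eq_zero, ← sub_smul] at h
    exact sub_eq_zero.1 (smul_one_eq_zero h)
  refine ⟨γ, hτ, hQ, ?_⟩
  have h := he.vol_map γ hQ
  have h' : vol Q (e.map γ) = vol Q e := by
    have : vol Q (e.map γ) = (↑α⁻¹ : CliffordAlgebra Q) * vol Q e * α := by
      simp only [vol, Basis.map_apply, hτ _]
      simp [mul_assoc]
    rw [this, mul_assoc, ← he.mul_vol, ← mul_assoc, Units.inv_mul, one_mul]
  rw [h', ← sub_eq_zero] at h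
  nth_rw 1 [← one_smul F (vol Q e)] at h
  rw [← sub_smul, smul_eq_zero, or_iff_left he.vol_ne_zero] at h
  exact (sub_eq_zero.1 h).symm

end Tau

end Paper

namespace Paper

section Lift

open CliffordAlgebra Module

variable {F W : Type*} [Field F] [AddCommGroup W] [Module F W] {Q : QuadraticForm F W}

/-- Averaging of `t` over the operators `x ↦ ι(eᵢ)⁻¹ x ι(γ eᵢ)`. -/
def avg (e : Basis (Fin 3) F W) (γ : W ≃ₗ[F] W) (t : CliffordAlgebra Q) : CliffordAlgebra Q :=
  t + ∑ i, (Q (e i))⁻¹ • (ι Q (e i) * t * ι Q (γ (e i)))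

variable {e : Basis (Fin 3) F W} {γ : W ≃ₗ[F] W}

lemma IsOrthoBasis.basis_mul_avg (he : IsOrthoBasis Q e) (hγ : ∀ x, Q (γ x) = Q x)
    (hvol : vol Q (e.map γ) = vol Q e) (t : CliffordAlgebra Q) (i : Fin 3) :
    ι Q (e i) * avg e γ t = avg e γ t * ι Q (γ (e i)) := by
  have he' := he.map γ hγ
  have q0 := he.ne_zero 0
  have q1 := he.ne_zero 1
  have q2 := he.ne_zero 2
  have h10 := he.anticomm (i := 0) (j := 1) (by decide)
  have h20 := he.anticomm (i := 0) (j := 2) (by decide)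
  have h21 := he.anticomm (i := 1) (j := 2) (by decide)
  have m12 := he.basis_one_mul_two
  have m02 := he.basis_zero_mul_two
  have m01 := he.basis_zero_mul_one
  have h10' := he'.anticomm (i := 0) (j := 1) (by decide)
  have h20' := he'.anticomm (i := 0) (j := 2) (by decide)
  have h21' := he'.anticomm (i := 1) (j := 2) (by decide)
  have m12' := he'.basis_one_mul_two
  have m02' := he'.basis_zero_mul_two
  have m01' := he'.basis_zero_mul_one
  simp only [hvol, Basis.map_apply, hγ] at h10' h20' h21' m12' m02' m01'
  have hz : ∀ j k, ι Q (e j) * (vol Q e * (t * ι Q (γ (e k)))) =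
      ι Q (e j) * (t * (ι Q (γ (e k)) * vol Q e)) := by
    intro j k
    rw [← he.mul_vol, mul_assoc]
  have hs' : ∀ j, ι Q (γ (e j)) * ι Q (γ (e j)) = Q (e j) • 1 := fun j => by
    rw [ι_sq_smul, hγ]
  have hm : ∀ {a b c : CliffordAlgebra Q}, a * b = c → ∀ x, a * (b * x) = c * x :=
    fun h x => by rw [← mul_assoc, h]
  have k10 := hm h10
  have k20 := hm h20
  have k21 := hm h21
  have n12 := hm m12
  have n02 := hm m02
  have n01 := hm m01
  simp only [avg, Fin.sum_univ_three, mul_add, add_mul, mul_smul_comm, smul_mul_assoc]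
  fin_cases i
  · simp only [Fin.zero_eta, mul_assoc, ι_mul_ι_mul_self, n01, n02, hs', h10', h20', m01', m02',
      neg_mul, mul_neg, smul_mul_assoc, mul_smul_comm, hz, mul_one, smul_smul,
      inv_mul_cancel₀ q0, one_smul, smul_neg]
    module
  · simp only [Fin.mk_one, mul_assoc, ι_mul_ι_mul_self, k10, n01, n12, hs', h21', m01', m12',
      neg_mul, mul_neg, smul_mul_assoc, mul_smul_comm, hz, mul_one, smul_smul,
      inv_mul_cancel₀ q1, one_smul, smul_neg]
    module
  · simp only [Fin.reduceFinMk, mul_assoc, ι_mul_ι_mul_self, k20, k21, n02, n12, hs', m02', m12',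
      neg_mul, mul_neg, smul_mul_assoc, mul_smul_comm, hz, mul_one, smul_smul,
      inv_mul_cancel₀ q2, one_smul, smul_neg]
    module

lemma IsOrthoBasis.ι_mul_avg (he : IsOrthoBasis Q e) (hγ : ∀ x, Q (γ x) = Q x)
    (hvol : vol Q (e.map γ) = vol Q e) (t : CliffordAlgebra Q) (x : W) :
    ι Q x * avg e γ t = avg e γ t * ι Q (γ x) := by
  rw [← e.sum_repr x]
  simp only [map_sum, map_smul, Finset.sum_mul, Finset.mul_sum, smul_mul_assoc, mul_smul_comm,
    he.basis_mul_avg hγ hvol]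

/-- `∑ eᵢ⁻¹ w eᵢ = -w` for a vector `w` of a ternary space. -/
lemma IsOrthoBasis.sum_conj_ι (he : IsOrthoBasis Q e) (w : W) :
    ∑ i, (Q (e i))⁻¹ • (ι Q (e i) * ι Q w * ι Q (e i)) = -ι Q w := by
  have h10 := he.anticomm (i := 0) (j := 1) (by decide)
  have h20 := he.anticomm (i := 0) (j := 2) (by decide)
  have h21 := he.anticomm (i := 1) (j := 2) (by decide)
  have key : ∀ j, ∑ i, (Q (e i))⁻¹ • (ι Q (e i) * ι Q (e j) * ι Q (e i)) = -ι Q (e j) := by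
    intro j
    rw [Fin.sum_univ_three]
    fin_cases j
    · simp [mul_assoc, h10, h20, he.ne_zero, Algebra.algebraMap_eq_smul_one]
    · simp [mul_assoc, ι_mul_ι_mul_self, h10, h21, he.ne_zero, Algebra.algebraMap_eq_smul_one]
    · simp [mul_assoc, ι_mul_ι_mul_self, h20, h21, he.ne_zero, Algebra.algebraMap_eq_smul_one]
  have h : ∀ i, (Q (e i))⁻¹ • (ι Q (e i) * ι Q w * ι Q (e i)) =
      ∑ j, e.repr w j • ((Q (e i))⁻¹ • (ι Q (e i) * ι Q (e j) * ι Q (e i))) := by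
    intro i
    conv_lhs => rw [← e.sum_repr w]
    simp only [map_sum, map_smul, Finset.sum_mul, Finset.mul_sum, smul_mul_assoc, mul_smul_comm,
      Finset.smul_sum]
    exact Finset.sum_congr rfl fun j _ => smul_comm _ _ _
  simp only [h]
  rw [Finset.sum_comm]
  simp only [← Finset.smul_sum, key, smul_neg, Finset.sum_neg_distrib, ← map_smul, ← map_sum,
    e.sum_repr]

lemma IsOrthoBasis.sum_conj (he : IsOrthoBasis Q e) (a : F) (w : W) :
    ∑ i, (Q (e i))⁻¹ • (ι Q (e i) * (a • 1 + ι Q w * vol Q e) * ι Q (e i)) =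
      (3 * a) • 1 - ι Q w * vol Q e := by
  have h : ∀ i, (Q (e i))⁻¹ • (ι Q (e i) * (a • 1 + ι Q w * vol Q e) * ι Q (e i)) =
      a • 1 + (Q (e i))⁻¹ • (ι Q (e i) * ι Q w * ι Q (e i)) * vol Q e := by
    intro i
    rw [mul_add, add_mul, mul_smul_comm, mul_one, smul_mul_assoc, ι_sq_smul, smul_add,
      smul_comm a, smul_smul, inv_mul_cancel₀ (he.ne_zero i), one_smul, smul_mul_assoc]
    congr 2
    simp only [mul_assoc]
    rw [he.ι_mul_vol]
  simp only [h, Finset.sum_add_distrib, ← Finset.sum_mul, he.sum_conj_ι]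
  simp only [Fin.sum_univ_three, neg_mul]
  module

lemma even_avg (he : IsOrthoBasis Q e) {t : CliffordAlgebra Q} (ht : t ∈ even Q) :
    avg e γ t ∈ even Q := by
  obtain ⟨a, w, rfl⟩ := he.exists_of_mem_even ht
  refine add_mem ht (sum_mem fun i _ => Subalgebra.smul_mem _ ?_ _)
  rw [mul_add, add_mul, mul_smul_comm, mul_one, smul_mul_assoc]
  refine add_mem (Subalgebra.smul_mem _ (ι_mul_ι_mem_even _ _) _) ?_
  rw [← mul_assoc, mul_assoc, ← he.ι_mul_vol]
  exact mul_mem (ι_mul_ι_mem_even _ _) (ι_mul_vol_mem_even _)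

lemma IsOrthoBasis.avg_mul_vol (he : IsOrthoBasis Q e) (t : CliffordAlgebra Q) :
    avg e γ (t * vol Q e) = avg e γ t * vol Q e := by
  simp only [avg, add_mul, Finset.sum_mul, smul_mul_assoc, mul_assoc, he.ι_mul_vol]

variable [CharZero F]

lemma IsOrthoBasis.exists_avg_ne_zero (he : IsOrthoBasis Q e) :
    avg e γ (1 : CliffordAlgebra Q) ≠ 0 ∨ ∃ i, avg e γ (ι Q (e i)) ≠ 0 := by
  by_contra! hcon
  obtain ⟨h0, h1⟩ := hcon
  have hsum : avg e γ (1 : CliffordAlgebra Q) +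
      ∑ i, (Q (e i))⁻¹ • (ι Q (e i) * avg e γ (ι Q (e i))) = (4 : F) • 1 := by
    have h2 : ∀ i, (Q (e i))⁻¹ • (ι Q (e i) * avg e γ (ι Q (e i))) =
        1 + ∑ j, (Q (e j))⁻¹ •
          ((Q (e i))⁻¹ • (ι Q (e i) * ι Q (e j) * ι Q (e i)) * ι Q (γ (e j))) := by
      intro i
      simp only [avg, mul_add, smul_add, ι_sq_smul, smul_smul, inv_mul_cancel₀ (he.ne_zero i),
        one_smul, Finset.mul_sum, Finset.smul_sum, mul_smul_comm, smul_mul_assoc, mul_assoc]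
      congr 1
      exact Finset.sum_congr rfl fun j _ => by rw [mul_comm]
    simp only [h2, Finset.sum_add_distrib]
    rw [Finset.sum_comm]
    simp only [← Finset.smul_sum, ← Finset.sum_mul, he.sum_conj_ι]
    simp only [avg, mul_one, neg_mul, smul_neg, Finset.sum_neg_distrib]
    simp only [Fin.sum_univ_three]
    module
  rw [h0] at hsum
  simp only [h1, mul_zero, smul_zero, Finset.sum_const_zero, add_zero] at hsum
  exact (by norm_num : (4 : F) ≠ 0) (smul_one_eq_zero hsum.symm)

lemma IsOrthoBasis.exists_intertwiner (he : IsOrthoBasis Q e) (hγ : ∀ x, Q (γ x) = Q x)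
    (hvol : vol Q (e.map γ) = vol Q e) :
    ∃ α ∈ even Q, α ≠ 0 ∧ ∀ x : W, ι Q x * α = α * ι Q (γ x) := by
  rcases he.exists_avg_ne_zero (γ := γ) with h | ⟨i, h⟩
  · exact ⟨_, even_avg he (one_mem _), h, he.ι_mul_avg hγ hvol _⟩
  · refine ⟨_, even_avg he (ι_mul_vol_mem_even (e := e) (e i)), ?_, he.ι_mul_avg hγ hvol _⟩
    rw [he.avg_mul_vol]
    intro h0
    exact h (he.mul_vol_injective (by rw [h0, zero_mul]))

/-- A vector `w` such that `w u w = 0` for all vectors `u` is zero. -/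
lemma IsOrthoBasis.eq_zero_of_ι_mul_ι_mul_ι (he : IsOrthoBasis Q e) {w : W} (hQ : Q w = 0)
    (h : ∀ u, ι Q w * ι Q u * ι Q w = 0) : w = 0 := by
  by_contra hw
  have hp : ∀ u, QuadraticMap.polar Q w u = 0 := by
    intro u
    have h1 := h u
    rw [ι_mul_ι_mul_ι, hQ, zero_smul, sub_zero] at h1
    have h2 := ι_inj (Q := Q) (h1.trans (map_zero (ι Q)).symm)
    exact (smul_eq_zero.1 h2).resolve_right hw
  apply hw
  rw [← e.sum_repr w]
  refine Finset.sum_eq_zero fun i _ => ?_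
  have h3 := hp (e i)
  rw [← e.sum_repr w, ← QuadraticMap.polarBilin_apply_apply, map_sum, LinearMap.sum_apply,
    Finset.sum_eq_single i] at h3
  · rw [map_smul, LinearMap.smul_apply, QuadraticMap.polarBilin_apply_apply,
      QuadraticMap.polar_self] at h3
    have := he.ne_zero i
    have h4 : e.repr w i = 0 := by simpa [this] using h3
    rw [h4, zero_smul]
  · intro j _ hj
    rw [map_smul, LinearMap.smul_apply, QuadraticMap.polarBilin_apply_apply,
      he.polar_eq_zero j i hj, smul_zero]
  · intro hi; exact absurd (Finset.mem_univ i) hi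

/-- The homomorphism `τ` is surjective for ternary spaces. -/
lemma IsOrthoBasis.exists_unit (he : IsOrthoBasis Q e) (hγ : ∀ x, Q (γ x) = Q x)
    (hdet : LinearMap.det (γ : W →ₗ[F] W) = 1) :
    ∃ α : (CliffordAlgebra Q)ˣ, IsGPlusUnit F W Q α ∧ IsTau F W Q γ α := by
  have hvol : vol Q (e.map γ) = vol Q e := by rw [he.vol_map γ hγ, hdet, one_smul]
  obtain ⟨α, hα, h0, hint⟩ := he.exists_intertwiner hγ hvol
  obtain ⟨n, h1, h2⟩ := he.exists_norm hα
  have hn : n ≠ 0 := by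
    rintro rfl
    rw [zero_smul] at h1
    have hodd : ∀ x : W, α * ι Q x * reverse α = 0 := by
      intro x
      obtain ⟨x, rfl⟩ := γ.surjective x
      rw [← hint, mul_assoc, h1, mul_zero]
    obtain ⟨a, w, rfl⟩ := he.exists_of_mem_even hα
    set α := a • 1 + ι Q w * vol Q e with hαdef
    have hr : reverse α = a • 1 + ι Q (-w) * vol Q e := by
      rw [hαdef, he.reverse_eq, map_neg, neg_mul, sub_eq_add_neg]
    have hsum : α * ∑ i, (Q (e i))⁻¹ • (ι Q (e i) * reverse α * ι Q (e i)) = 0 := by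
      rw [Finset.mul_sum]
      refine Finset.sum_eq_zero fun i _ => ?_
      rw [mul_smul_comm, ← mul_assoc, ← mul_assoc, hodd, zero_mul, smul_zero]
    have hα4 : ∑ i, (Q (e i))⁻¹ • (ι Q (e i) * reverse α * ι Q (e i)) =
        (4 * a) • 1 - reverse α := by
      rw [hr, he.sum_conj]
      module
    rw [hα4, mul_sub, h1, sub_zero, mul_smul_comm, mul_one, smul_eq_zero, or_iff_left h0] at hsum
    have ha : a = 0 := by simpa using hsum
    have hα' : α = ι Q w * vol Q e := by rw [hαdef, ha]; simp
    have hr' : reverse α = -(ι Q w * vol Q e) := by rw [hα', he.reverse_ι_mul_vol]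
    have hV : ∀ (x : W) (y : CliffordAlgebra Q), vol Q e * (ι Q x * y) = ι Q x * (vol Q e * y) :=
      fun x y => by rw [← mul_assoc, ← he.ι_mul_vol, mul_assoc]
    have hu : ∀ u, ι Q w * ι Q u * ι Q w = 0 := by
      intro u
      have h3 := hodd u
      rw [hr', hα', mul_neg, neg_eq_zero] at h3
      have h4 : ι Q w * ι Q u * ι Q w * vol Q e * vol Q e = 0 := by
        rw [← h3]
        simp only [mul_assoc, hV]
      rw [he.mul_vol_mul_vol] at h4
      exact (smul_eq_zero.1 h4).resolve_left he.volSq_ne_zero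
    have hQ : Q w = 0 := by
      rw [hr', hα', mul_neg, neg_eq_zero] at h1
      have h4 : (Q w * volSq Q e) • (1 : CliffordAlgebra Q) = 0 := by
        rw [← h1]
        simp only [mul_assoc, hV, ι_mul_ι_mul_self, he.vol_mul_vol, smul_smul]
      exact (mul_eq_zero.1 (smul_one_eq_zero h4)).resolve_right he.volSq_ne_zero
    apply h0
    rw [hα', he.eq_zero_of_ι_mul_ι_mul_ι hQ hu]
    simp
  have hu1 : α * (n⁻¹ • reverse α) = 1 := by
    rw [mul_smul_comm, h1, smul_smul, inv_mul_cancel₀ hn, one_smul]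
  have hu2 : (n⁻¹ • reverse α) * α = 1 := by
    rw [smul_mul_assoc, h2, smul_smul, inv_mul_cancel₀ hn, one_smul]
  refine ⟨⟨α, n⁻¹ • reverse α, hu1, hu2⟩, ⟨hα, ?_⟩, ?_⟩
  · exact Subalgebra.smul_mem _ ((reverse_mem_evenOdd_iff Q).2 hα) _
  · intro x
    change ι Q (γ x) = n⁻¹ • reverse α * ι Q x * α
    rw [mul_assoc, hint, ← mul_assoc, hu2, one_mul]

end Lift

end Paper

namespace Paper

section Localization

open IsDedekindDomain

variable {R F : Type*} [CommRing R] [Field F] [Algebra R F]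
variable {W : Type*} [AddCommGroup W] [Module F W] [Module R W] [IsScalarTower R F W]
variable {W' : Type*} [AddCommGroup W'] [Module F W'] [Module R W'] [IsScalarTower R F W']
variable {v : HeightOneSpectrum R} {N N' : Submodule R W}

lemma one_notMem (v : HeightOneSpectrum R) : (1 : R) ∉ v.asIdeal :=
  v.asIdeal.ne_top_iff_one.1 v.isPrime.ne_top

lemma mul_notMem {s t : R} (hs : s ∉ v.asIdeal) (ht : t ∉ v.asIdeal) : s * t ∉ v.asIdeal :=
  fun h => (v.isPrime.mem_or_mem h).elim hs ht

lemma le_localAt (N : Submodule R W) : N ≤ localAt R W v N :=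
  fun x hx => ⟨1, one_notMem v, by rwa [one_smul]⟩

lemma localAt_mono (h : N ≤ N') : localAt R W v N ≤ localAt R W v N' :=
  fun _ ⟨s, hs, hx⟩ => ⟨s, hs, h hx⟩

lemma mem_localAt_of_smul_mem {x : W} {s : R} (hs : s ∉ v.asIdeal)
    (h : s • x ∈ localAt R W v N) : x ∈ localAt R W v N := by
  obtain ⟨t, ht, hx⟩ := h
  exact ⟨t * s, mul_notMem ht hs, by rwa [mul_smul]⟩

lemma localAt_localAt : localAt R W v (localAt R W v N) = localAt R W v N :=
  le_antisymm (fun _ ⟨_, hs, hx⟩ => mem_localAt_of_smul_mem hs hx) (le_localAt _)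

lemma map_localAt {f : W →ₗ[R] W'} (hf : Function.Bijective f) :
    Submodule.map f (localAt R W v N) = localAt R W' v (Submodule.map f N) := by
  ext y
  constructor
  · rintro ⟨x, ⟨s, hs, hx⟩, rfl⟩
    exact ⟨s, hs, s • x, hx, map_smul _ _ _⟩
  · rintro ⟨s, hs, n, hn, hy⟩
    obtain ⟨x, rfl⟩ := hf.2 y
    rw [← map_smul] at hy
    exact ⟨x, ⟨s, hs, hf.1 hy ▸ hn⟩, rfl⟩

lemma latAction_localAt (γ : W ≃ₗ[F] W) :
    latAction R F W γ (localAt R W v N) = localAt R W v (latAction R F W γ N) :=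
  map_localAt γ.bijective

lemma latAction_symm_latAction (γ : W ≃ₗ[F] W) :
    latAction R F W γ.symm (latAction R F W γ N) = N := by
  ext x
  simp [latAction]

variable [IsDedekindDomain R]

/-- Over a Dedekind domain which is not a field, submodules with the same localizations are
equal. -/
lemma eq_of_localAt_eq (hR : ¬ IsField R)
    (h : ∀ v, localAt R W v N = localAt R W v N') : N = N' := by
  have key : ∀ A B : Submodule R W, (∀ v, localAt R W v A = localAt R W v B) → A ≤ B := by
    intro A B hAB x hx
    have htop : B.comap (LinearMap.toSpanSingleton R W x) = ⊤ := by
      by_contra hne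
      obtain ⟨m, hm, hle⟩ := Ideal.exists_le_maximal _ hne
      obtain ⟨s, hs, hsx⟩ := (hAB ⟨m, hm.isPrime, Ring.ne_bot_of_isMaximal_of_not_isField hm hR⟩).le
        (le_localAt A hx)
      exact hs (hle hsx)
    have h1 : (1 : R) ∈ B.comap (LinearMap.toSpanSingleton R W x) := htop ▸ Submodule.mem_top
    simpa using h1
  exact le_antisymm (key _ _ h) (key _ _ fun v => (h v).symm)

/-- A nonzero element of a Dedekind domain becomes, away from a prime `v`, a divisor of an element
prime to `v`. -/
lemma exists_notMem_dvd_mul (v : HeightOneSpectrum R) {d : R} (hd : d ≠ 0) :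
    ∃ t ∉ v.asIdeal, ∃ k : ℕ, ∀ u ∈ v.asIdeal ^ k, d ∣ u * t := by
  have hfin : FiniteMultiplicity v.asIdeal (Ideal.span {d}) :=
    FiniteMultiplicity.of_prime_left v.prime (by simpa using hd)
  obtain ⟨J, hJ, hvJ⟩ := hfin.exists_eq_pow_mul_and_not_dvd
  rw [Ideal.dvd_iff_le] at hvJ
  obtain ⟨t, htJ, ht⟩ := SetLike.not_le_iff_exists.1 hvJ
  refine ⟨t, ht, multiplicity v.asIdeal (Ideal.span {d}), fun u hu => ?_⟩
  rw [← Ideal.mem_span_singleton, hJ]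
  exact Ideal.mul_mem_mul hu htJ

lemma exists_mem_pow_notMem {v w : HeightOneSpectrum R} (h : w ≠ v) (k : ℕ) :
    ∃ u ∈ v.asIdeal ^ k, u ∉ w.asIdeal := by
  by_contra! hle
  have h1 : v.asIdeal ≤ w.asIdeal := w.isPrime.le_of_pow_le hle
  exact h (HeightOneSpectrum.ext (v.isMaximal.eq_of_le w.isPrime.ne_top h1).symm)

/-- Existence of a lattice with prescribed localizations, uniformly commensurable with a fixed
lattice `K`. -/
lemma localAt_iInf_eq {P : HeightOneSpectrum R → Submodule R W} {K : Submodule R W} {c d : R}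
    (hc : c ≠ 0) (hd : d ≠ 0) (hP : ∀ w, localAt R W w (P w) = P w)
    (h1 : ∀ w, ∀ x ∈ P w, c • x ∈ localAt R W w K)
    (h2 : ∀ w, ∀ x ∈ localAt R W w K, d • x ∈ P w) (v : HeightOneSpectrum R) :
    localAt R W v (⨅ w, P w) = P v := by
  refine le_antisymm ((localAt_mono (iInf_le P v)).trans (hP v).le) fun x hx => ?_
  obtain ⟨s, hs, hsx⟩ := h1 v x hx
  obtain ⟨t, ht, k, hk⟩ := exists_notMem_dvd_mul v (mul_ne_zero hd hc)
  refine ⟨t * s, mul_notMem ht hs, (Submodule.mem_iInf _).2 fun w => ?_⟩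
  by_cases hw : w = v
  · subst hw
    exact (P w).smul_mem _ hx
  · obtain ⟨u, hu, huw⟩ := exists_mem_pow_notMem hw k
    obtain ⟨r, hr⟩ := hk u hu
    rw [← hP w]
    refine ⟨u, huw, ?_⟩
    rw [smul_smul, ← mul_assoc, hr,
      show d * c * r * s = r * (d * (s * c)) by ring, mul_smul, mul_smul, mul_smul]
    exact (P w).smul_mem _ (h2 w _ (le_localAt _ hsx))

end Localization

section Commensurable

variable {R F : Type*} [CommRing R] [IsDomain R] [Field F] [Algebra R F] [IsFractionRing R F]
variable {W : Type*} [AddCommGroup W] [Module F W] [Module R W] [IsScalarTower R F W]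
variable {M : Submodule R W}

lemma exists_smul_mem_of_span_eq_top (hM : Submodule.span F (M : Set W) = ⊤) (x : W) :
    ∃ c : R, c ≠ 0 ∧ c • x ∈ M := by
  have hx : x ∈ Submodule.span F (M : Set W) := hM ▸ Submodule.mem_top
  induction hx using Submodule.span_induction with
  | mem x hx => exact ⟨1, one_ne_zero, by rwa [one_smul]⟩
  | zero => exact ⟨1, one_ne_zero, by simp⟩
  | add x y _ _ hx hy =>
    obtain ⟨c, hc, hx⟩ := hx
    obtain ⟨d, hd, hy⟩ := hy
    refine ⟨c * d, mul_ne_zero hc hd, ?_⟩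
    rw [smul_add]
    refine M.add_mem ?_ ?_
    · rw [mul_comm, mul_smul]
      exact M.smul_mem _ hx
    · rw [mul_smul]
      exact M.smul_mem _ hy
  | smul a x _ hx =>
    obtain ⟨c, hc, hx⟩ := hx
    obtain ⟨r, s, hs, rfl⟩ := IsFractionRing.div_surjective (A := R) a
    have hs0 := nonZeroDivisors.ne_zero hs
    refine ⟨s * c, mul_ne_zero hs0 hc, ?_⟩
    have hs1 : algebraMap R F s ≠ 0 := by
      simpa using (IsFractionRing.injective R F).ne hs0
    have : (s * c) • (algebraMap R F r / algebraMap R F s) • x = r • (c • x) := by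
      rw [← algebraMap_smul F (s * c), ← algebraMap_smul F r, ← algebraMap_smul F c, smul_smul,
        smul_smul, map_mul]
      congr 1
      field_simp
    rw [this]
    exact M.smul_mem _ hx

lemma exists_smul_mem_of_fg {T : Submodule R W} (hT : T.FG)
    (h : ∀ x ∈ T, ∃ c : R, c ≠ 0 ∧ c • x ∈ M) : ∃ c : R, c ≠ 0 ∧ ∀ x ∈ T, c • x ∈ M := by
  obtain ⟨s, rfl⟩ := hT
  choose! c hc hcM using h
  refine ⟨∏ x ∈ s, c x, Finset.prod_ne_zero_iff.2 fun x hx => hc x (Submodule.subset_span hx),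
    fun x hx => ?_⟩
  have hle : Submodule.span R (s : Set W) ≤ M.comap (LinearMap.lsmul R W (∏ x ∈ s, c x)) := by
    rw [Submodule.span_le]
    intro y hy
    obtain ⟨r, hr⟩ := Finset.dvd_prod_of_mem c (Finset.mem_coe.1 hy)
    change (∏ x ∈ s, c x) • y ∈ M
    rw [hr, mul_comm, mul_smul]
    exact M.smul_mem _ (hcM y (Submodule.subset_span hy))
  exact hle hx

end Commensurable

end Paper

namespace Paper

section CliffordOrders

open CliffordAlgebra IsDedekindDomain

variable {R F : Type*} [CommRing R] [Field F] [Algebra R F]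
variable {W : Type*} [AddCommGroup W] [Module F W] [Module R W] [IsScalarTower R F W]
variable {Q : QuadraticForm F W} {N N' M : Submodule R W}

lemma ι_smul_tower (r : R) (x : W) : ι Q (r • x) = r • ι Q x :=
  (ι Q).map_smul_of_tower r x

lemma mem_APlusSub {y : CliffordAlgebra Q} :
    y ∈ APlusSub R F W Q N ↔ y ∈ even Q ∧ y ∈ cliffordOrder R F W Q N := Iff.rfl

lemma APlusSub_mono (h : N ≤ N') : APlusSub R F W Q N ≤ APlusSub R F W Q N' :=
  fun _ hx => ⟨hx.1, Algebra.adjoin_mono (Set.image_mono h) hx.2⟩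

lemma exists_smul_mem_cliffordOrder {v : HeightOneSpectrum R} {y : CliffordAlgebra Q}
    (hy : y ∈ cliffordOrder R F W Q (localAt R W v N)) :
    ∃ s ∉ v.asIdeal, s • y ∈ cliffordOrder R F W Q N := by
  induction hy using Algebra.adjoin_induction with
  | mem y hy =>
    obtain ⟨x, ⟨s, hs, hx⟩, rfl⟩ := hy
    exact ⟨s, hs, Algebra.subset_adjoin ⟨_, hx, ι_smul_tower s x⟩⟩
  | algebraMap r =>
    exact ⟨1, one_notMem v, by rw [one_smul]; exact Subalgebra.algebraMap_mem _ r⟩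
  | add x y _ _ hx hy =>
    obtain ⟨s, hs, hx⟩ := hx
    obtain ⟨t, ht, hy⟩ := hy
    refine ⟨s * t, mul_notMem hs ht, ?_⟩
    rw [smul_add]
    refine add_mem ?_ ?_
    · rw [mul_comm, mul_smul]
      exact Subalgebra.smul_mem _ hx t
    · rw [mul_smul]
      exact Subalgebra.smul_mem _ hy s
  | mul x y _ _ hx hy =>
    obtain ⟨s, hs, hx⟩ := hx
    obtain ⟨t, ht, hy⟩ := hy
    refine ⟨s * t, mul_notMem hs ht, ?_⟩
    rw [← smul_mul_smul_comm]
    exact mul_mem hx hy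

lemma localAt_APlusSub_localAt {v : HeightOneSpectrum R} :
    localAt R (CliffordAlgebra Q) v (APlusSub R F W Q (localAt R W v N)) =
      localAt R (CliffordAlgebra Q) v (APlusSub R F W Q N) := by
  refine le_antisymm ?_ (localAt_mono (APlusSub_mono (le_localAt N)))
  rintro y ⟨s, hs, hev, hy⟩
  obtain ⟨t, ht, hty⟩ := exists_smul_mem_cliffordOrder hy
  refine ⟨t * s, mul_notMem ht hs, ?_⟩
  rw [mul_smul]
  exact ⟨Subalgebra.smul_mem (evenR R F W Q) hev t, hty⟩

lemma conjMap_apply (α : (CliffordAlgebra Q)ˣ) (y : CliffordAlgebra Q) :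
    conjMap R F W Q α y = ↑α⁻¹ * y * α := by
  rw [mul_assoc]
  rfl

lemma conjMap_inv_conjMap (α : (CliffordAlgebra Q)ˣ) (y : CliffordAlgebra Q) :
    conjMap R F W Q α⁻¹ (conjMap R F W Q α y) = y := by
  simp [conjMap_apply, mul_assoc]

lemma conjMap_conjMap_inv (α : (CliffordAlgebra Q)ˣ) (y : CliffordAlgebra Q) :
    conjMap R F W Q α (conjMap R F W Q α⁻¹ y) = y := by
  simp [conjMap_apply, mul_assoc]

lemma conjMap_bijective (α : (CliffordAlgebra Q)ˣ) : Function.Bijective (conjMap R F W Q α) :=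
  Function.bijective_iff_has_inverse.2 ⟨_, conjMap_inv_conjMap α, conjMap_conjMap_inv α⟩

lemma conjMap_mul (α : (CliffordAlgebra Q)ˣ) (x y : CliffordAlgebra Q) :
    conjMap R F W Q α (x * y) = conjMap R F W Q α x * conjMap R F W Q α y := by
  simp [conjMap_apply, mul_assoc]

lemma conjMap_algebraMap (α : (CliffordAlgebra Q)ˣ) (r : R) :
    conjMap R F W Q α (algebraMap R _ r) = algebraMap R _ r := by
  rw [conjMap_apply, ← Algebra.commutes, mul_assoc, Units.inv_mul, mul_one]

lemma IsGPlusUnit.conjMap_mem_even {α : (CliffordAlgebra Q)ˣ} (hα : IsGPlusUnit F W Q α)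
    {y : CliffordAlgebra Q} (hy : y ∈ even Q) : conjMap R F W Q α y ∈ even Q := by
  rw [conjMap_apply]
  exact mul_mem (mul_mem hα.2 hy) hα.1

lemma IsGPlusUnit.inv {α : (CliffordAlgebra Q)ˣ} (hα : IsGPlusUnit F W Q α) :
    IsGPlusUnit F W Q α⁻¹ :=
  ⟨hα.2, by simpa using hα.1⟩

lemma IsTau.conjMap_ι {α : (CliffordAlgebra Q)ˣ} {γ : W ≃ₗ[F] W} (h : IsTau F W Q γ α) (x : W) :
    conjMap R F W Q α (ι Q x) = ι Q (γ x) := by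
  rw [conjMap_apply, h x]

lemma IsTau.inv {α : (CliffordAlgebra Q)ˣ} {γ : W ≃ₗ[F] W} (h : IsTau F W Q γ α) :
    IsTau F W Q γ.symm α⁻¹ := by
  intro x
  obtain ⟨x, rfl⟩ := γ.surjective x
  simp [h x, mul_assoc]

lemma IsTau.conjMap_mem_cliffordOrder {α : (CliffordAlgebra Q)ˣ} {γ : W ≃ₗ[F] W}
    (h : IsTau F W Q γ α) {y : CliffordAlgebra Q} (hy : y ∈ cliffordOrder R F W Q N) :
    conjMap R F W Q α y ∈ cliffordOrder R F W Q (latAction R F W γ N) := by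
  induction hy using Algebra.adjoin_induction with
  | mem y hy =>
    obtain ⟨x, hx, rfl⟩ := hy
    rw [h.conjMap_ι]
    exact Algebra.subset_adjoin ⟨_, Submodule.mem_map_of_mem hx, rfl⟩
  | algebraMap r =>
    rw [conjMap_algebraMap]
    exact Subalgebra.algebraMap_mem _ r
  | add x y _ _ hx hy =>
    rw [map_add]
    exact add_mem hx hy
  | mul x y _ _ hx hy =>
    rw [conjMap_mul]
    exact mul_mem hx hy

/-- `α⁻¹ A⁺(N) α = A⁺(N τ(α))`. -/
lemma IsTau.map_conjMap_APlusSub {α : (CliffordAlgebra Q)ˣ} {γ : W ≃ₗ[F] W}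
    (h : IsTau F W Q γ α) (hα : IsGPlusUnit F W Q α) :
    Submodule.map (conjMap R F W Q α) (APlusSub R F W Q N) =
      APlusSub R F W Q (latAction R F W γ N) := by
  apply le_antisymm
  · rintro _ ⟨y, hy, rfl⟩
    exact ⟨hα.conjMap_mem_even hy.1, h.conjMap_mem_cliffordOrder hy.2⟩
  · intro y hy
    refine ⟨conjMap R F W Q α⁻¹ y, ⟨hα.inv.conjMap_mem_even hy.1, ?_⟩, conjMap_conjMap_inv α y⟩
    have := h.inv.conjMap_mem_cliffordOrder hy.2
    rwa [latAction_symm_latAction] at this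

lemma IsTau.map_conjMap_localAt {α : (CliffordAlgebra Q)ˣ} {γ : W ≃ₗ[F] W}
    (h : IsTau F W Q γ α) (hα : IsGPlusUnit F W Q α) (v : HeightOneSpectrum R) :
    Submodule.map (conjMap R F W Q α) (localAt R _ v (APlusSub R F W Q N)) =
      localAt R _ v (APlusSub R F W Q (latAction R F W γ N)) := by
  rw [map_localAt (conjMap_bijective α), h.map_conjMap_APlusSub hα]

/-- Adjoining one more vector `m` to a subring `B` of the Clifford algebra generated by vectors
gives `B + B m`. -/
lemma adjoin_insert_le {s : Set W} {m : W} (hm : Q m ∈ (algebraMap R F).range)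
    (hp : ∀ x ∈ s, QuadraticMap.polar Q m x ∈ (algebraMap R F).range) :
    Subalgebra.toSubmodule (Algebra.adjoin R (ι Q '' insert m s)) ≤
      Subalgebra.toSubmodule (Algebra.adjoin R (ι Q '' s)) ⊔
        (Subalgebra.toSubmodule (Algebra.adjoin R (ι Q '' s))).map
          (LinearMap.mulRight R (ι Q m)) := by
  set B := Algebra.adjoin R (ι Q '' s) with hB
  set C := Subalgebra.toSubmodule B ⊔
    (Subalgebra.toSubmodule B).map (LinearMap.mulRight R (ι Q m)) with hC
  have hmem : ∀ y, y ∈ C ↔ ∃ b ∈ B, ∃ d ∈ B, b + d * ι Q m = y := by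
    intro y
    simp [hC, Submodule.mem_sup]
  have hBC : ∀ b ∈ B, b ∈ C := fun b hb => Submodule.mem_sup_left hb
  have hBmC : ∀ b ∈ B, b * ι Q m ∈ C := fun b hb => Submodule.mem_sup_right ⟨b, hb, rfl⟩
  have hscal : ∀ a ∈ (algebraMap R F).range, algebraMap F (CliffordAlgebra Q) a ∈ B := by
    rintro _ ⟨r, rfl⟩
    rw [← IsScalarTower.algebraMap_apply]
    exact Subalgebra.algebraMap_mem _ r
  have hmul : ∀ b ∈ B, ∀ c ∈ C, b * c ∈ C := by
    intro b hb c hc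
    obtain ⟨x, hx, y, hy, rfl⟩ := (hmem c).1 hc
    rw [mul_add, ← mul_assoc]
    exact add_mem (hBC _ (mul_mem hb hx)) (hBmC _ (mul_mem hb hy))
  have hmB : ∀ b ∈ B, ι Q m * b ∈ C := by
    intro b hb
    induction hb using Algebra.adjoin_induction with
    | mem y hy =>
      obtain ⟨x, hx, rfl⟩ := hy
      rw [eq_sub_of_add_eq (ι_mul_ι_add_swap (Q := Q) m x)]
      exact sub_mem (hBC _ (hscal _ (hp x hx))) (hBmC _ (Algebra.subset_adjoin ⟨x, hx, rfl⟩))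
    | algebraMap r =>
      rw [← Algebra.commutes]
      exact hBmC _ (Subalgebra.algebraMap_mem _ r)
    | add x y _ _ hx hy =>
      rw [mul_add]
      exact add_mem hx hy
    | mul x y _ hy hx hy' =>
      obtain ⟨b, hb, d, hd, hbd⟩ := (hmem _).1 hx
      rw [← mul_assoc, ← hbd, add_mul, mul_assoc d]
      exact add_mem (hBC _ (mul_mem hb hy)) (hmul d hd _ hy')
  have hmC : ∀ c ∈ C, ι Q m * c ∈ C := by
    intro c hc
    obtain ⟨x, hx, y, hy, rfl⟩ := (hmem c).1 hc
    obtain ⟨b, hb, d, hd, hbd⟩ := (hmem _).1 (hmB y hy)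
    rw [mul_add, ← mul_assoc, ← hbd, add_mul, mul_assoc d, ι_sq_scalar]
    exact add_mem (hmB x hx) (add_mem (hBmC b hb) (hBC _ (mul_mem hd (hscal _ hm))))
  have hall : ∀ y ∈ Algebra.adjoin R (ι Q '' insert m s), ∀ c ∈ C, y * c ∈ C := by
    intro y hy
    induction hy using Algebra.adjoin_induction with
    | mem y hy =>
      obtain ⟨x, rfl | hx, rfl⟩ := hy
      · exact hmC
      · exact hmul _ (Algebra.subset_adjoin ⟨x, hx, rfl⟩)
    | algebraMap r => exact hmul _ (Subalgebra.algebraMap_mem _ r)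
    | add x y _ _ hx hy =>
      intro c hc
      rw [add_mul]
      exact add_mem (hx c hc) (hy c hc)
    | mul x y _ _ hx hy =>
      intro c hc
      rw [mul_assoc]
      exact hx _ (hy c hc)
  intro y hy
  simpa using hall y hy 1 (hBC 1 (one_mem _))

lemma fg_adjoin_ι (s : Finset W) (hQ : ∀ x ∈ s, Q x ∈ (algebraMap R F).range)
    (hp : ∀ x ∈ s, ∀ y ∈ s, QuadraticMap.polar Q x y ∈ (algebraMap R F).range) :
    (Subalgebra.toSubmodule (Algebra.adjoin R (ι Q '' (s : Set W)))).FG := by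
  classical
  induction s using Finset.induction_on with
  | empty =>
    rw [Finset.coe_empty, Set.image_empty, Algebra.adjoin_empty, Algebra.toSubmodule_bot,
      Submodule.one_eq_span]
    exact Submodule.fg_span_singleton (1 : CliffordAlgebra Q)
  | insert m s _ ih =>
    have hfg := ih (fun x hx => hQ x (Finset.mem_insert_of_mem hx))
      (fun x hx y hy => hp x (Finset.mem_insert_of_mem hx) y (Finset.mem_insert_of_mem hy))
    rw [Finset.coe_insert]
    have heq : Subalgebra.toSubmodule (Algebra.adjoin R (ι Q '' insert m (s : Set W))) =
        Subalgebra.toSubmodule (Algebra.adjoin R (ι Q '' (s : Set W))) ⊔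
        (Subalgebra.toSubmodule (Algebra.adjoin R (ι Q '' (s : Set W)))).map
          (LinearMap.mulRight R (ι Q m)) := by
      have hle : Algebra.adjoin R (ι Q '' (s : Set W)) ≤
          Algebra.adjoin R (ι Q '' insert m (s : Set W)) :=
        Algebra.adjoin_mono (Set.image_mono (Set.subset_insert _ _))
      refine le_antisymm (adjoin_insert_le (hQ m (Finset.mem_insert_self _ _)) fun x hx =>
        hp m (Finset.mem_insert_self _ _) x (Finset.mem_insert_of_mem hx)) (sup_le hle ?_)
      rintro _ ⟨b, hb, rfl⟩
      exact (Algebra.adjoin R (ι Q '' insert m (s : Set W))).mul_mem (hle hb)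
        (Algebra.subset_adjoin ⟨m, Set.mem_insert _ _, rfl⟩)
    rw [heq]
    exact hfg.sup (hfg.map _)

lemma fg_cliffordOrder (hM : M.FG) (hQ : ∀ x ∈ M, Q x ∈ (algebraMap R F).range) :
    (Subalgebra.toSubmodule (cliffordOrder R F W Q M)).FG := by
  obtain ⟨s, hs⟩ := hM
  have hsM : ∀ x ∈ s, x ∈ M := fun x hx => hs ▸ Submodule.subset_span hx
  have heq : cliffordOrder R F W Q M = Algebra.adjoin R (ι Q '' (s : Set W)) := by
    refine le_antisymm (Algebra.adjoin_le ?_) (Algebra.adjoin_mono (Set.image_mono hsM))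
    rintro _ ⟨x, hx, rfl⟩
    have hle : M ≤ (Subalgebra.toSubmodule (Algebra.adjoin R (ι Q '' (s : Set W)))).comap
        ((ι Q).restrictScalars R) := by
      rw [← hs, Submodule.span_le]
      exact fun y hy => Algebra.subset_adjoin ⟨y, hy, rfl⟩
    exact hle hx
  rw [heq]
  exact fg_adjoin_ι s (fun x hx => hQ x (hsM x hx)) fun x hx y hy =>
    sub_mem (sub_mem (hQ _ (add_mem (hsM x hx) (hsM y hy))) (hQ x (hsM x hx))) (hQ y (hsM y hy))

end CliffordOrders

end Paper

namespace Paper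

section Ternary

open CliffordAlgebra IsDedekindDomain Module LinearMap.BilinMap

variable {R F : Type*} [CommRing R] [Field F] [Algebra R F]
variable {W : Type*} [AddCommGroup W] [Module F W] [Module R W] [IsScalarTower R F W]
variable {Q : QuadraticForm F W} {N M : Submodule R W} {e : Basis (Fin 3) F W}

/-- The submodule of vectors `x` with `x·vol ∈ o`. -/
def vecPart (Q : QuadraticForm F W) (e : Basis (Fin 3) F W)
    (o : Submodule R (CliffordAlgebra Q)) : Submodule R W :=
  o.comap (((LinearMap.mulRight F (vol Q e)).comp (ι Q)).restrictScalars R)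

lemma mem_vecPart {o : Submodule R (CliffordAlgebra Q)} {x : W} :
    x ∈ vecPart Q e o ↔ ι Q x * vol Q e ∈ o := Iff.rfl

lemma mem_localAt_vecPart {o : Submodule R (CliffordAlgebra Q)} {v : HeightOneSpectrum R} {x : W} :
    x ∈ localAt R W v (vecPart Q e o) ↔
      ι Q x * vol Q e ∈ localAt R (CliffordAlgebra Q) v o := by
  refine exists_congr fun s => and_congr_right fun _ => ?_
  rw [mem_vecPart, ι_smul_tower, smul_mul_assoc]

lemma IsOrthoBasis.conjMap_ι_mul_vol (he : IsOrthoBasis Q e) {α : (CliffordAlgebra Q)ˣ}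
    {γ : W ≃ₗ[F] W} (h : IsTau F W Q γ α) (x : W) :
    conjMap R F W Q α (ι Q x * vol Q e) = ι Q (γ x) * vol Q e := by
  rw [conjMap_apply, h x]
  simp only [mul_assoc, he.mul_vol (α : CliffordAlgebra Q)]

lemma ι_mul_vol_mem_APlusSub (hM : ∀ i, ∃ c : R, c ≠ 0 ∧ c • e i ∈ M) [IsDomain R] :
    ∃ c : R, c ≠ 0 ∧ ∀ x ∈ M, c • x ∈ vecPart Q e (APlusSub R F W Q M) := by
  choose c hc hcM using hM
  refine ⟨c 0 * c 1 * c 2, mul_ne_zero (mul_ne_zero (hc 0) (hc 1)) (hc 2), fun x hx => ?_⟩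
  refine mem_APlusSub.2 ⟨ι_mul_vol_mem_even _, ?_⟩
  have hι : ∀ y ∈ M, ι Q y ∈ cliffordOrder R F W Q M := fun y hy =>
    Algebra.subset_adjoin ⟨y, hy, rfl⟩
  have h : ι Q ((c 0 * c 1 * c 2) • x) * vol Q e =
      ι Q x * (ι Q (c 0 • e 0) * ι Q (c 1 • e 1) * ι Q (c 2 • e 2)) := by
    simp only [vol, ι_smul_tower, smul_mul_assoc, mul_smul_comm, smul_smul]
    congr 1
    ring
  change ι Q _ * vol Q e ∈ _
  rw [h]
  exact mul_mem (hι x hx) (mul_mem (mul_mem (hι _ (hcM 0)) (hι _ (hcM 1))) (hι _ (hcM 2)))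

lemma IsOrthoBasis.exists_smul_mem_of_mem_vecPart [CharZero F] [IsDomain R] [IsNoetherianRing R]
    [IsFractionRing R F]
    (he : IsOrthoBasis Q e) (hM : M.FG) (hspan : Submodule.span F (M : Set W) = ⊤)
    (hQ : ∀ x ∈ M, Q x ∈ (algebraMap R F).range) :
    ∃ c : R, c ≠ 0 ∧ ∀ x ∈ vecPart Q e (APlusSub R F W Q M), c • x ∈ M := by
  refine exists_smul_mem_of_fg ?_ fun x _ => exists_smul_mem_of_span_eq_top hspan x
  have hinj : Function.Injective
      (((LinearMap.mulRight F (vol Q e)).comp (ι Q)).restrictScalars R) := fun x y hxy =>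
    ι_inj (he.mul_vol_injective hxy)
  refine Submodule.fg_of_fg_map_injective _ hinj ((fg_cliffordOrder hM hQ).of_le ?_)
  rintro _ ⟨x, hx, rfl⟩
  exact hx.2

lemma isSOElem_of_isometry [CharZero F] {ψ : LinearMap.BilinForm F W} (hψ : ψ.IsSymm)
    {γ : W ≃ₗ[F] W} (hγ : ∀ x, toQuadraticMap ψ (γ x) = toQuadraticMap ψ x)
    (hdet : LinearMap.det (γ : W →ₗ[F] W) = 1) : IsSOElem F W ψ γ := by
  refine ⟨fun x y => ?_, hdet⟩
  have h := hγ (x + y)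
  have hx := hγ x
  have hy := hγ y
  simp only [toQuadraticMap_apply, map_add, LinearMap.add_apply] at h hx hy
  have h1 : ψ (γ y) (γ x) = ψ (γ x) (γ y) := hψ.eq _ _
  have h2 : ψ y x = ψ x y := hψ.eq _ _
  rw [hx, hy, h1, h2] at h
  have h3 : (2 : F) * ψ (γ x) (γ y) = 2 * ψ x y := by linear_combination h
  exact mul_left_cancel₀ two_ne_zero h3

lemma IsSOElem.symm {ψ : LinearMap.BilinForm F W} {γ : W ≃ₗ[F] W} (h : IsSOElem F W ψ γ) :
    IsSOElem F W ψ γ.symm := by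
  refine ⟨fun x y => ?_, ?_⟩
  · rw [← h.1, γ.apply_symm_apply, γ.apply_symm_apply]
  · have := LinearEquiv.det_mul_det_symm γ
    rwa [h.2, one_mul] at this

/-- Lattices in the genus of `M` give orders in the genus of `A⁺(M)`. -/
theorem IsOrthoBasis.orderInGenus [CharZero F] [IsDedekindDomain R]
    {ψ : LinearMap.BilinForm F W} (he : IsOrthoBasis (toQuadraticMap ψ) e)
    (hN : InGenus R F W ψ M N) :
    OrderInGenus R F W (toQuadraticMap ψ) (APlusSub R F W (toQuadraticMap ψ) M)
      (APlusSub R F W (toQuadraticMap ψ) N) := by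
  intro v
  obtain ⟨γ, hγ, hloc⟩ := hN v
  obtain ⟨α, hα, hτ⟩ := he.exists_unit (fun x => hγ.symm.1 x x) hγ.symm.2
  refine ⟨α, hα, ?_⟩
  rw [hτ.map_conjMap_localAt hα, ← localAt_APlusSub_localAt, ← latAction_localAt, ← hloc,
    latAction_symm_latAction, localAt_APlusSub_localAt]

/-- Orders in the genus of `A⁺(M)` come from lattices in the genus of `M`. -/
theorem IsOrthoBasis.exists_inGenus [CharZero F] [IsDedekindDomain R] [IsFractionRing R F]
    (hR : ¬ IsField R) {ψ : LinearMap.BilinForm F W} (hψ : ψ.IsSymm)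
    (he : IsOrthoBasis (toQuadraticMap ψ) e) (hM : M.FG)
    (hspan : Submodule.span F (M : Set W) = ⊤)
    (hQ : ∀ x ∈ M, toQuadraticMap ψ x ∈ (algebraMap R F).range)
    {o : Submodule R (CliffordAlgebra (toQuadraticMap ψ))}
    (ho : OrderInGenus R F W (toQuadraticMap ψ) (APlusSub R F W (toQuadraticMap ψ) M) o) :
    ∃ N : Submodule R W, InGenus R F W ψ M N ∧ APlusSub R F W (toQuadraticMap ψ) N = o := by
  choose α hα hαo using ho
  choose γ hτ hγ hdet using fun v => he.exists_isTau (hα v)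
  obtain ⟨c, hc, hcM⟩ := ι_mul_vol_mem_APlusSub (Q := toQuadraticMap ψ)
    fun i => exists_smul_mem_of_span_eq_top hspan (e i)
  obtain ⟨d, hd, hdM⟩ := he.exists_smul_mem_of_mem_vecPart hM hspan hQ
  have hN := localAt_iInf_eq (P := fun w => localAt R W w (latAction R F W (γ w) M))
    (K := vecPart (toQuadraticMap ψ) e o) hc hd (fun w => localAt_localAt) ?_ ?_
  · refine ⟨⨅ w, localAt R W w (latAction R F W (γ w) M), fun v => ⟨(γ v).symm,
      (isSOElem_of_isometry hψ (hγ v) (hdet v)).symm, ?_⟩,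
      eq_of_localAt_eq hR fun v => ?_⟩
    · rw [hN v, latAction_localAt, latAction_symm_latAction]
    · rw [← localAt_APlusSub_localAt, hN v, localAt_APlusSub_localAt,
        ← (hτ v).map_conjMap_localAt (hα v), hαo]
  · rintro w x ⟨s, hs, m, hm, hx⟩
    rw [mem_localAt_vecPart]
    refine mem_localAt_of_smul_mem hs ?_
    rw [← hαo w]
    refine ⟨ι (toQuadraticMap ψ) (c • m) * vol (toQuadraticMap ψ) e,
      le_localAt _ (hcM m hm), ?_⟩
    rw [he.conjMap_ι_mul_vol (hτ w)]
    have hx' : γ w m = s • x := hx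
    have hcm : γ w (c • m) = c • γ w m := (γ w).toLinearMap.map_smul_of_tower c m
    rw [← smul_mul_assoc, ← ι_smul_tower, smul_comm s c, ← hx', hcm]
  · intro w y hy
    rw [mem_localAt_vecPart, ← hαo w] at hy
    obtain ⟨a, ⟨s, hs, ha⟩, hay⟩ := hy
    obtain ⟨x, rfl⟩ := (γ w).surjective y
    rw [← he.conjMap_ι_mul_vol (R := R) (hτ w)] at hay
    rw [(conjMap_bijective (α w)).1 hay] at ha
    rw [← smul_mul_assoc, ← ι_smul_tower] at ha
    refine ⟨s, hs, d • s • x, hdM _ ha, ?_⟩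
    change γ w (d • s • x) = s • d • γ w x
    rw [smul_comm s d]
    exact ((γ w).toLinearMap.map_smul_of_tower d (s • x)).trans
      (congrArg (d • ·) ((γ w).toLinearMap.map_smul_of_tower s x))

end Ternary

section Quaternary

open Module LinearMap.BilinMap

variable {R F : Type*} [CommRing R] [Field F] [Algebra R F]

lemma exists_isOrthoBasis [CharZero F] {W : Type*} [AddCommGroup W] [Module F W]
    (hW : finrank F W = 3) {ψ : LinearMap.BilinForm F W} (hψ : ψ.IsSymm)
    (hnd : LinearMap.BilinForm.Nondegenerate ψ) :
    ∃ e : Basis (Fin 3) F W, IsOrthoBasis (toQuadraticMap ψ) e := by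
  have : FiniteDimensional F W := .of_finrank_pos (by omega)
  have : Invertible (2 : F) := invertibleOfNonzero two_ne_zero
  obtain ⟨b, hb⟩ := LinearMap.BilinForm.exists_orthogonal_basis
    (LinearMap.BilinForm.isSymm_iff.1 hψ)
  refine ⟨b.reindex (finCongr hW), ⟨fun i j hij => ?_, fun i => ?_⟩⟩
  · rw [polar_toQuadraticMap, Basis.reindex_apply, Basis.reindex_apply,
      hb ((finCongr hW).symm.injective.ne hij), hb ((finCongr hW).symm.injective.ne hij.symm),
      add_zero]
  · rw [toQuadraticMap_apply, Basis.reindex_apply]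
    exact LinearMap.BilinForm.iIsOrtho.not_isOrtho_basis_self_of_nondegenerate hb hnd _

lemma finrank_ker_eq_three {V : Type*} [AddCommGroup V] [Module F V]
    (hV : finrank F V = 4) {f : V →ₗ[F] F} {h : V} (hf : f h ≠ 0) :
    finrank F (LinearMap.ker f) = 3 := by
  have : FiniteDimensional F V := .of_finrank_pos (by omega)
  have h1 := f.finrank_range_add_finrank_ker
  have h2 : LinearMap.range f = ⊤ := LinearMap.range_eq_top.2 (f.surjective (by
    rintro rfl
    exact hf rfl))
  rw [h2, finrank_top, finrank_self, hV] at h1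
  omega

lemma nondegenerate_restrict_ker_flip {V : Type*} [AddCommGroup V] [Module F V]
    {φ : LinearMap.BilinForm F V} (hsymm : φ.IsSymm)
    (hnd : LinearMap.BilinForm.Nondegenerate φ) {h : V} (hq : φ h h ≠ 0) :
    LinearMap.BilinForm.Nondegenerate
      (LinearMap.BilinForm.restrict φ (LinearMap.ker (φ.flip h))) := by
  have heq : LinearMap.ker (φ.flip h) = LinearMap.BilinForm.orthogonal φ (F ∙ h) := by
    ext x
    rw [LinearMap.BilinForm.mem_orthogonal_iff, LinearMap.mem_ker]
    change φ x h = 0 ↔ _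
    constructor
    · intro hx y hy
      obtain ⟨a, rfl⟩ := Submodule.mem_span_singleton.1 hy
      have : φ h x = 0 := (hsymm.eq h x).trans hx
      simp [this]
    · intro hx
      exact (hsymm.eq x h).trans (hx h (Submodule.mem_span_singleton_self h))
  rw [heq]
  exact LinearMap.BilinForm.restrict_nondegenerate_orthogonal_spanSingleton φ hnd hsymm.isRefl hq

variable {V : Type*} [AddCommGroup V] [Module F V] [Module R V] [IsScalarTower R F V]

lemma span_comap_subtype_eq_top [IsDomain R] [IsFractionRing R F] {L : Submodule R V}
    (hL : Submodule.span F (L : Set V) = ⊤) (U : Submodule F V) :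
    Submodule.span F (L.comap (U.subtype.restrictScalars R) : Set U) = ⊤ := by
  refine (Submodule.eq_top_iff_forall_basis_mem (Basis.ofVectorSpace F U)).2 fun i => ?_
  obtain ⟨c, hc, hcL⟩ := exists_smul_mem_of_span_eq_top hL (Basis.ofVectorSpace F U i : V)
  have hc' : algebraMap R F c ≠ 0 := by
    simpa using (IsFractionRing.injective R F).ne hc
  rw [← Submodule.smul_mem_iff _ hc', algebraMap_smul]
  exact Submodule.subset_span hcL

lemma fg_comap_subtype [IsNoetherianRing R] {L : Submodule R V} (hL : L.FG)
    (U : Submodule F V) : (L.comap (U.subtype.restrictScalars R)).FG :=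
  Submodule.fg_of_fg_map_injective _ (Subtype.val_injective)
    (hL.of_le (Submodule.map_comap_le _ _))

lemma not_isField_of_isIntegralClosure [CharZero F] [IsIntegralClosure R ℤ F] : ¬ IsField R := by
  intro hR
  have hint : Algebra.IsIntegral ℤ R := IsIntegralClosure.isIntegral_algebra ℤ F
  have hinj : Function.Injective (algebraMap ℤ R) := by
    intro a b hab
    have := congrArg (algebraMap R F) hab
    simpa using this
  exact Int.not_isField (isField_of_isIntegral_of_isField hinj hR)

end Quaternary

end Paper

open Paper NumberField IsDedekindDomain

section

variable (F : Type*) [Field F] [NumberField F]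
variable (R : Type*) [CommRing R] [IsDedekindDomain R] [Algebra R F] [IsFractionRing R F]
  [IsIntegralClosure R ℤ F]
variable (V : Type*) [AddCommGroup V] [Module F V] [Module R V] [IsScalarTower R F V]

set_option synthInstance.maxHeartbeats 1000000 in
set_option maxHeartbeats 1000000 in
/-- The `SO^ψ`-genus of `L∩W` is determined by the genus of the
order `𝔬 = A⁺(L∩W)`: every lattice in the `SO^ψ`-genus of `L∩W` gives an order in the
genus of `𝔬`, and every order in the genus of `𝔬` arises as `A⁺(N)` for some lattice
`N` in the `SO^ψ`-genus of `L∩W`. -/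
theorem statement6
    (hV : Module.finrank F V = 4)
    (φ : LinearMap.BilinForm F V) (hsymm : φ.IsSymm)
    (hnd : LinearMap.BilinForm.Nondegenerate φ)
    (h : V) (hq : φ h h ≠ 0)
    (Wsub : Submodule F V) (hWsub : Wsub = LinearMap.ker (φ.flip h))
    (L : Submodule R V) (hL : IsMaximalLat R F V φ L) :
    (∀ N : Submodule R ↥Wsub,
        InGenus R F ↥Wsub (LinearMap.BilinForm.restrict φ Wsub) (Submodule.comap ((Wsub.subtype).restrictScalars R) L) N →
        OrderInGenus R F ↥Wsub (LinearMap.BilinMap.toQuadraticMap (LinearMap.BilinForm.restrict φ Wsub)) (APlusSub R F ↥Wsub (LinearMap.BilinMap.toQuadraticMap (LinearMap.BilinForm.restrict φ Wsub)) (Submodule.comap ((Wsub.subtype).restrictScalars R) L))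
          (APlusSub R F ↥Wsub (LinearMap.BilinMap.toQuadraticMap (LinearMap.BilinForm.restrict φ Wsub)) N)) ∧
    (∀ o : Submodule R (CliffordAlgebra (LinearMap.BilinMap.toQuadraticMap (LinearMap.BilinForm.restrict φ Wsub))),
        OrderInGenus R F ↥Wsub (LinearMap.BilinMap.toQuadraticMap (LinearMap.BilinForm.restrict φ Wsub)) (APlusSub R F ↥Wsub (LinearMap.BilinMap.toQuadraticMap (LinearMap.BilinForm.restrict φ Wsub)) (Submodule.comap ((Wsub.subtype).restrictScalars R) L)) o →
        ∃ N : Submodule R ↥Wsub,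
          InGenus R F ↥Wsub (LinearMap.BilinForm.restrict φ Wsub) (Submodule.comap ((Wsub.subtype).restrictScalars R) L) N ∧
          APlusSub R F ↥Wsub (LinearMap.BilinMap.toQuadraticMap (LinearMap.BilinForm.restrict φ Wsub)) N = o) := by
  subst hWsub
  have hsymm' : (LinearMap.BilinForm.restrict φ (LinearMap.ker (φ.flip h))).IsSymm :=
    ⟨fun x y => hsymm.eq x y⟩
  obtain ⟨e, he⟩ := exists_isOrthoBasis
    (ψ := LinearMap.BilinForm.restrict φ (LinearMap.ker (φ.flip h)))
    (finrank_ker_eq_three hV (f := φ.flip h) hq) hsymm'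
    (nondegenerate_restrict_ker_flip hsymm hnd hq)
  exact ⟨fun N hN => he.orderInGenus hN, fun o ho =>
    he.exists_inGenus (not_isField_of_isIntegralClosure (F := F)) hsymm'
      (fg_comap_subtype hL.1.1.1 _) (span_comap_subtype_eq_top hL.1.1.2 _)
      (fun x hx => hL.1.2 x hx) ho⟩

end
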